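/- MTL_ℤ+C (Metric Temporal Logic with integer constants extended with all counting modalities) has the same expressive power as FO_ℤ: every FO_ℤ formula with one free variable has an equivalent MTL_ℤ+C formula and vice versa. -/

import Mathlib

namespace MTLPaper

variable {K : AddSubgroup ℝ} {P : Type}

/-- `K ⊆ ℝ` is dense: between any two elements of `K` there is another element of `K`. -/
def DenseK (K : AddSubgroup ℝ) : Prop :=
  ∀ a ∈ K, ∀ b ∈ K, a < b → ∃ c ∈ K, a < c ∧ c < b

/-- A term of `FO_K`: a variable index together with a constant shift from `K`
(`(x, c)` denotes the term `x + c`; iterated shifts collapse since `K` is a group). -/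
abbrev Term (K : AddSubgroup ℝ) : Type := ℕ × K

/-- Value of a term under a valuation of the variables. -/
def Term.val (v : ℕ → ℝ) (t : Term K) : ℝ := v t.1 + (t.2 : ℝ)

/-- Formulas of the monadic logic of order and metric `FO_K`, over monadic predicates `P`. -/
inductive FO (K : AddSubgroup ℝ) (P : Type) : Type
  | tt : FO K P
  | atom : P → Term K → FO K P
  | lt : Term K → Term K → FO K P
  | conj : FO K P → FO K P → FO K P
  | neg : FO K P → FO K P
  | ex : ℕ → FO K P → FO K P

namespace FO

/-- Satisfaction of an `FO_K` formula over a signal `f` and a valuation `v`. -/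
def sat (f : ℝ → Set P) : FO K P → (ℕ → ℝ) → Prop
  | tt, _ => True
  | atom p t, v => p ∈ f (Term.val v t)
  | lt s t, v => Term.val v s < Term.val v t
  | conj φ ψ, v => sat f φ v ∧ sat f ψ v
  | neg φ, v => ¬ sat f φ v
  | ex x φ, v => ∃ r : ℝ, sat f φ (Function.update v x r)

/-- Free variables of an `FO_K` formula. -/
def free : FO K P → Set ℕ
  | tt => ∅
  | atom _ t => {t.1}
  | lt s t => {s.1, t.1}
  | conj φ ψ => free φ ∪ free ψ
  | neg φ => free φ
  | ex x φ => free φ \ {x}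

/-- Quantifier depth. -/
def qdepth : FO K P → ℕ
  | tt => 0
  | atom _ _ => 0
  | lt _ _ => 0
  | conj φ ψ => max (qdepth φ) (qdepth ψ)
  | neg φ => qdepth φ
  | ex _ φ => qdepth φ + 1

/-- Quantifier-free formulas. -/
def QFree : FO K P → Prop
  | tt => True
  | atom _ _ => True
  | lt _ _ => True
  | conj φ ψ => QFree φ ∧ QFree ψ
  | neg φ => QFree φ
  | ex _ _ => False

/-- `<`-free formulas. -/
def LtFree : FO K P → Prop
  | tt => True
  | atom _ _ => True
  | lt _ _ => False
  | conj φ ψ => LtFree φ ∧ LtFree ψ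
  | neg φ => LtFree φ
  | ex _ φ => LtFree φ

/-- Membership in `Bet_K(t₁,t₂)`: every quantified subformula `∃z ψ` has the form
`∃z ((t₁ < z < t₂) ∧ χ)`, and every monadic atom `P(t)` has `t` a bound occurrence of a
variable (no shift).  `B` records the set of variables bound so far. -/
def Bet (t₁ t₂ : Term K) : FO K P → Set ℕ → Prop
  | tt, _ => True
  | atom _ t, B => t.2 = (0 : K) ∧ t.1 ∈ B
  | lt _ _, _ => True
  | conj φ ψ, B => Bet t₁ t₂ φ B ∧ Bet t₁ t₂ ψ B
  | neg φ, B => Bet t₁ t₂ φ B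
  | ex z (conj (conj (lt s u) (lt u' t)) χ), B =>
      s = t₁ ∧ t = t₂ ∧ u = (z, (0 : K)) ∧ u' = (z, (0 : K)) ∧ Bet t₁ t₂ χ (insert z B)
  | ex _ _, _ => False

/-- `φ(x)` is `N`-bounded: it belongs to `Bet_K(x - N, x + N)`. -/
def NBounded (x : ℕ) (N : K) (φ : FO K P) : Prop :=
  Bet (x, -N) (x, N) φ (∅ : Set ℕ)

/-- The relativized quantifier `∃ y ∈ (s, t). φ`. -/
def guard (s t : Term K) (y : ℕ) (φ : FO K P) : FO K P :=
  ex y (conj (conj (lt s (y, (0 : K))) (lt (y, (0 : K)) t)) φ)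

/-- The guard interval of the body of a quantifier on `z`, if it has guarded shape. -/
def guardOf (z : ℕ) : FO K P → Set (Term K × Term K)
  | conj (conj (lt s u) (lt u' t)) _ =>
      {p | u = (z, (0 : K)) ∧ u' = (z, (0 : K)) ∧ p = (s, t)}
  | _ => ∅

/-- The guard intervals occurring in a formula. -/
def intervals : FO K P → Set (Term K × Term K)
  | tt => ∅
  | atom _ _ => ∅
  | lt _ _ => ∅
  | conj φ ψ => intervals φ ∪ intervals ψ
  | neg φ => intervals φ
  | ex z φ => guardOf z φ ∪ intervals φ

/-- Hierarchical Interval Formulas (HIFs).  Every `<`-free quantifier-free formula is a HIF;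
HIFs are closed under negation and disjunction (`φ ∨ ψ := ¬(¬φ ∧ ¬ψ)`); and if `φ(x̄, y)` is a
HIF such that the only guard intervals in `φ` involving `y` and a variable free in `φ` are of
the form `(x_l + c_l + c, y + c)` or `(y + c, x_r + c_r + c)` for some `c ∈ K`, then
`∃ y ∈ (x_l + c_l, x_r + c_r). φ` is a HIF. -/
inductive IsHIF : FO K P → Prop
  | base {φ : FO K P} : QFree φ → LtFree φ → IsHIF φ
  | negI {φ : FO K P} : IsHIF φ → IsHIF (neg φ)
  | disjI {φ ψ : FO K P} : IsHIF φ → IsHIF ψ → IsHIF (neg (conj (neg φ) (neg ψ)))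
  | exI {φ : FO K P} {y xl xr : ℕ} {cl cr : K} :
      IsHIF φ → xl ≠ y → xr ≠ y →
      (∀ s t : Term K, (s, t) ∈ intervals φ →
        (s.1 = y → t.1 ≠ y → t.1 ∈ free φ → ∃ c : K, s = (y, c) ∧ t = (xr, cr + c)) ∧
        (t.1 = y → s.1 ≠ y → s.1 ∈ free φ → ∃ c : K, t = (y, c) ∧ s = (xl, cl + c))) →
      IsHIF (guard (xl, cl) (xr, cr) y φ)

/-- A conjunction of constraints of the form `x_j + c < x_k + c'`. -/
def IsConstraintConj : FO K P → Prop
  | tt => True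
  | atom _ _ => False
  | lt _ _ => True
  | conj φ ψ => IsConstraintConj φ ∧ IsConstraintConj ψ
  | neg _ => False
  | ex _ _ => False

/-- The term `t` applies no nonzero shift unless its variable is `x`. -/
def TermOnly (x : ℕ) (t : Term K) : Prop := t.2 = (0 : K) ∨ t.1 = x

/-- The unary functions `+c` are applied only to the variable `x`. -/
def FnOnly (x : ℕ) : FO K P → Prop
  | tt => True
  | atom _ t => TermOnly x t
  | lt s t => TermOnly x s ∧ TermOnly x t
  | conj φ ψ => FnOnly x φ ∧ FnOnly x ψ
  | neg φ => FnOnly x φ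
  | ex _ φ => FnOnly x φ

end FO

/-- Equivalence of two `FO_K` formulas: same truth value for every signal and valuation. -/
def EquivFO (φ ψ : FO K P) : Prop :=
  ∀ (f : ℝ → Set P) (v : ℕ → ℝ), φ.sat f v ↔ ψ.sat f v

/-- An interval `I ⊆ (0,∞)` with endpoints in `K_{≥0} ∪ {∞}` (`hi = none` means `∞`). -/
structure MTLI (K : AddSubgroup ℝ) where
  lo : ℝ
  lo_mem : lo ∈ K
  lo_nonneg : 0 ≤ lo
  loClosed : Bool
  hi : Option ℝ
  hi_mem : ∀ h : ℝ, hi = some h → h ∈ K ∧ 0 ≤ h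
  hiClosed : Bool
  pos : lo = 0 → loClosed = false

namespace MTLI

/-- Membership in the interval. -/
def mem (I : MTLI K) (t : ℝ) : Prop :=
  (if I.loClosed then I.lo ≤ t else I.lo < t) ∧
  ∀ h : ℝ, I.hi = some h → (if I.hiClosed then t ≤ h else t < h)

/-- The interval is bounded. -/
def Bounded (I : MTLI K) : Prop := I.hi ≠ none

/-- The supremum of the interval, in `ℝ ∪ {∞}`. -/
def supW (I : MTLI K) : WithTop ℝ :=
  match I.hi with
  | none => ⊤
  | some h => (h : WithTop ℝ)

/-- The singleton (punctual) interval `{N}`, for `N ∈ K`, `N > 0`. -/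
def single (N : ℝ) (hm : N ∈ K) (h0 : 0 < N) : MTLI K where
  lo := N
  lo_mem := hm
  lo_nonneg := h0.le
  loClosed := true
  hi := some N
  hi_mem := fun h hh => by
    obtain rfl := (Option.some.inj hh).symm
    exact ⟨hm, h0.le⟩
  hiClosed := true
  pos := fun h => absurd h h0.ne'

/-- The unconstrained interval `(0, ∞)`. -/
def full : MTLI K where
  lo := 0
  lo_mem := zero_mem K
  lo_nonneg := le_refl 0
  loClosed := false
  hi := none
  hi_mem := fun _ hh => nomatch hh
  hiClosed := false
  pos := fun _ => rfl

end MTLI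

/-- Formulas of `MTL_K` over atomic propositions `P`. -/
inductive MTL (K : AddSubgroup ℝ) (P : Type) : Type
  | tt : MTL K P
  | atom : P → MTL K P
  | conj : MTL K P → MTL K P → MTL K P
  | neg : MTL K P → MTL K P
  | untl : MTL K P → MTL K P → MTLI K → MTL K P
  | sinc : MTL K P → MTL K P → MTLI K → MTL K P

namespace MTL

/-- Satisfaction of an `MTL_K` formula over a signal, at a point.
`untl φ ψ I` is `φ U_I ψ` and `sinc φ ψ I` is `φ S_I ψ`. -/
def sat (f : ℝ → Set P) : MTL K P → ℝ → Prop
  | tt, _ => True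
  | atom p, r => p ∈ f r
  | conj φ ψ, r => sat f φ r ∧ sat f ψ r
  | neg φ, r => ¬ sat f φ r
  | untl φ ψ I, r =>
      ∃ t : ℝ, r < t ∧ I.mem (t - r) ∧ sat f ψ t ∧ ∀ u, r < u → u < t → sat f φ u
  | sinc φ ψ I, r =>
      ∃ t : ℝ, t < r ∧ I.mem (r - t) ∧ sat f ψ t ∧ ∀ u, t < u → u < r → sat f φ u

/-- All intervals occurring in the temporal operators are bounded. -/
def AllBounded : MTL K P → Prop
  | tt => True
  | atom _ => True
  | conj φ ψ => AllBounded φ ∧ AllBounded ψ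
  | neg φ => AllBounded φ
  | untl φ ψ I => I.Bounded ∧ AllBounded φ ∧ AllBounded ψ
  | sinc φ ψ I => I.Bounded ∧ AllBounded φ ∧ AllBounded ψ

/-- LTL formulas: MTL formulas using only the interval `(0, ∞)`. -/
def IsLTL : MTL K P → Prop
  | tt => True
  | atom _ => True
  | conj φ ψ => IsLTL φ ∧ IsLTL ψ
  | neg φ => IsLTL φ
  | untl φ ψ I => I = MTLI.full ∧ IsLTL φ ∧ IsLTL ψ
  | sinc φ ψ I => I = MTLI.full ∧ IsLTL φ ∧ IsLTL ψ

/-- Future reach. -/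
noncomputable def fr : MTL K P → WithTop ℝ
  | tt => 0
  | atom _ => 0
  | conj φ ψ => max (fr φ) (fr ψ)
  | neg φ => fr φ
  | untl φ ψ I => I.supW + max (fr φ) (fr ψ)
  | sinc φ ψ I => max (fr φ) (WithTop.map (fun x => x - I.lo) (fr ψ))

/-- Past reach. -/
noncomputable def pr : MTL K P → WithTop ℝ
  | tt => 0
  | atom _ => 0
  | conj φ ψ => max (pr φ) (pr ψ)
  | neg φ => pr φ
  | untl φ ψ I => max (pr φ) (WithTop.map (fun x => x - I.lo) (pr ψ))
  | sinc φ ψ I => I.supW + max (pr φ) (pr ψ)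

/-- Boolean combinations of formulas from a class `S`. -/
inductive BC (S : MTL K P → Prop) : MTL K P → Prop
  | base {φ : MTL K P} : S φ → BC S φ
  | negB {φ : MTL K P} : BC S φ → BC S (neg φ)
  | conjB {φ ψ : MTL K P} : BC S φ → BC S ψ → BC S (conj φ ψ)

end MTL

/-- Equivalence of two `MTL_K` formulas. -/
def EquivMTL (φ ψ : MTL K P) : Prop :=
  ∀ (f : ℝ → Set P) (r : ℝ), φ.sat f r ↔ ψ.sat f r

/-- Equivalence of an `FO_K` formula with (at most) free variable `0` and an `MTL_K` formula. -/
def EquivFOMTL (φ : FO K P) (ψ : MTL K P) : Prop :=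
  ∀ (f : ℝ → Set P) (r : ℝ), φ.sat f (fun _ => r) ↔ ψ.sat f r

/-- `MTL_K` and `FO_K` have the same expressive power. -/
def SameExpressive (K : AddSubgroup ℝ) (P : Type) : Prop :=
  (∀ φ : FO K P, φ.free ⊆ {0} → ∃ ψ : MTL K P, EquivFOMTL φ ψ) ∧
  (∀ ψ : MTL K P, ∃ φ : FO K P, φ.free ⊆ {0} ∧ EquivFOMTL φ ψ)

/-- Formulas of `MTL_K` with counting modalities. -/
inductive MTLC (K : AddSubgroup ℝ) (P : Type) : Type
  | tt : MTLC K P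
  | atom : P → MTLC K P
  | conj : MTLC K P → MTLC K P → MTLC K P
  | neg : MTLC K P → MTLC K P
  | untl : MTLC K P → MTLC K P → MTLI K → MTLC K P
  | sinc : MTLC K P → MTLC K P → MTLI K → MTLC K P
  | fcount : ℕ → MTLC K P → MTLC K P
  | pcount : ℕ → MTLC K P → MTLC K P

namespace MTLC

/-- Satisfaction of an `MTL_K+C` formula. -/
def sat (f : ℝ → Set P) : MTLC K P → ℝ → Prop
  | tt, _ => True
  | atom p, r => p ∈ f r
  | conj φ ψ, r => sat f φ r ∧ sat f ψ r
  | neg φ, r => ¬ sat f φ r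
  | untl φ ψ I, r =>
      ∃ t : ℝ, r < t ∧ I.mem (t - r) ∧ sat f ψ t ∧ ∀ u, r < u → u < t → sat f φ u
  | sinc φ ψ I, r =>
      ∃ t : ℝ, t < r ∧ I.mem (r - t) ∧ sat f ψ t ∧ ∀ u, t < u → u < r → sat f φ u
  | fcount n φ, r =>
      ∃ s : Fin n → ℝ, StrictMono s ∧ ∀ i, s i ∈ Set.Ioo r (r + 1) ∧ sat f φ (s i)
  | pcount n φ, r =>
      ∃ s : Fin n → ℝ, StrictMono s ∧ ∀ i, s i ∈ Set.Ioo (r - 1) r ∧ sat f φ (s i)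

end MTLC

/-- The integers, as an additive subgroup of `ℝ`. -/
def intZ : AddSubgroup ℝ := AddSubgroup.zmultiples (1 : ℝ)

/-- Equivalence of an `FO_K` formula with free variable `0` and an `MTL_K+C` formula. -/
def EquivFOMTLC (φ : FO K P) (ψ : MTLC K P) : Prop :=
  ∀ (f : ℝ → Set P) (r : ℝ), φ.sat f (fun _ => r) ↔ ψ.sat f r

/-- Formulas of PQ2MLO: Q2MLO with punctuality. -/
inductive PQ (P : Type) : Type
  | tt : PQ P
  | atom : P → ℕ → PQ P
  | lt : ℕ → ℕ → PQ P
  | conj : PQ P → PQ P → PQ P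
  | neg : PQ P → PQ P
  | ex : ℕ → PQ P → PQ P
  | exFutI : ℕ → ℕ → PQ P → PQ P  -- ∃ y ∈ (x, x+1). ψ
  | exPastI : ℕ → ℕ → PQ P → PQ P -- ∃ y ∈ (x-1, x). ψ
  | exFutP : ℕ → ℕ → PQ P → PQ P  -- ∃ y (y = x+1 ∧ χ)
  | exPastP : ℕ → ℕ → PQ P → PQ P -- ∃ y (y = x-1 ∧ χ)

namespace PQ

/-- Satisfaction of a PQ2MLO formula. -/
def sat (f : ℝ → Set P) : PQ P → (ℕ → ℝ) → Prop
  | tt, _ => True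
  | atom p x, v => p ∈ f (v x)
  | lt x y, v => v x < v y
  | conj φ ψ, v => sat f φ v ∧ sat f ψ v
  | neg φ, v => ¬ sat f φ v
  | ex x φ, v => ∃ r : ℝ, sat f φ (Function.update v x r)
  | exFutI x y ψ, v => ∃ r : ℝ, v x < r ∧ r < v x + 1 ∧ sat f ψ (Function.update v y r)
  | exPastI x y ψ, v => ∃ r : ℝ, v x - 1 < r ∧ r < v x ∧ sat f ψ (Function.update v y r)
  | exFutP x y χ, v => ∃ r : ℝ, r = v x + 1 ∧ sat f χ (Function.update v y r)
  | exPastP x y χ, v => ∃ r : ℝ, r = v x - 1 ∧ sat f χ (Function.update v y r)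

/-- Free variables of a PQ2MLO formula. -/
def free : PQ P → Set ℕ
  | tt => ∅
  | atom _ x => {x}
  | lt x y => {x, y}
  | conj φ ψ => free φ ∪ free ψ
  | neg φ => free φ
  | ex x φ => free φ \ {x}
  | exFutI x y ψ => insert x (free ψ \ {y})
  | exPastI x y ψ => insert x (free ψ \ {y})
  | exFutP x y χ => insert x (free χ \ {y})
  | exPastP x y χ => insert x (free χ \ {y})

/-- Well-formedness: in `∃y∈(x,x+1) ψ` and `∃y∈(x-1,x) ψ` the formula `ψ` has exactly the
free variables `x` and `y`; in `∃y (y = x±1 ∧ χ)` the formula `χ` has exactly the free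
variable `y`. -/
def WF : PQ P → Prop
  | tt => True
  | atom _ _ => True
  | lt _ _ => True
  | conj φ ψ => WF φ ∧ WF ψ
  | neg φ => WF φ
  | ex _ φ => WF φ
  | exFutI x y ψ => x ≠ y ∧ free ψ = {x, y} ∧ WF ψ
  | exPastI x y ψ => x ≠ y ∧ free ψ = {x, y} ∧ WF ψ
  | exFutP x y χ => x ≠ y ∧ free χ = {y} ∧ WF χ
  | exPastP x y χ => x ≠ y ∧ free χ = {y} ∧ WF χ

end PQ

/-- Equivalence of an `FO_ℤ` formula with free variable `0` and a PQ2MLO formula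
with free variable `0`. -/
def EquivFOPQ (φ : FO intZ P) (π : PQ P) : Prop :=
  ∀ (f : ℝ → Set P) (r : ℝ), φ.sat f (fun _ => r) ↔ π.sat f (fun _ => r)

/-- Equivalence of a PQ2MLO formula with free variable `0` and an `MTL_ℤ+C` formula. -/
def EquivPQMTLC (π : PQ P) (ψ : MTLC intZ P) : Prop :=
  ∀ (f : ℝ → Set P) (r : ℝ), π.sat f (fun _ => r) ↔ ψ.sat f r

/-- The singleton interval `{1}` over the integer constants. -/
def oneI : MTLI intZ := MTLI.single 1 (AddSubgroup.mem_zmultiples (1 : ℝ)) one_pos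

/-- The interpretation of the enlarged set of monadic predicates: the predicate `(p, c)`
(i.e. `P^c`) holds at `r` iff `p` holds at `r + c`. -/
def liftSig (K : AddSubgroup ℝ) (f : ℝ → Set P) : ℝ → Set (P × K) :=
  fun r => {pc : P × K | pc.1 ∈ f (r + (pc.2 : ℝ))}

/-- Semantics of a decomposition formula `δ(x,y)`:
`x < y ∧ ∃ z₀ … zₙ (x = z₀ < ⋯ < zₙ = y) ∧ ⋀ φᵢ(zᵢ) ∧ ⋀ ∀u (z_{i-1} < u < z_i → ψᵢ(u))`,
where the `φᵢ`, `ψᵢ` are MTL formulas regarded as unary predicates. -/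
def DecompSat (f : ℝ → Set P) (n : ℕ) (φ ψ : ℕ → MTL K P) (x y : ℝ) : Prop :=
  x < y ∧ ∃ z : ℕ → ℝ, z 0 = x ∧ z n = y ∧ (∀ i < n, z i < z (i + 1)) ∧
    (∀ i, 0 < i → i < n → (φ i).sat f (z i)) ∧
    (∀ i, 0 < i → i ≤ n → ∀ u, z (i - 1) < u → u < z i → (ψ i).sat f u)

/-- Semantics of `δ(x,y)` for abstract unary predicates (no `x < y` conjunct). -/
def Delta (φ ψ : ℕ → ℝ → Prop) (n : ℕ) (x y : ℝ) : Prop :=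
  ∃ z : ℕ → ℝ, z 0 = x ∧ z n = y ∧ (∀ i < n, z i < z (i + 1)) ∧
    (∀ i, 0 < i → i < n → φ i (z i)) ∧
    (∀ i, 0 < i → i ≤ n → ∀ u, z (i - 1) < u → u < z i → ψ i u)

/-- Semantics of `δⱼ(x,y)`: the restriction of `δ` to the first `j` formulas of
`ψ₁, φ₁, ψ₂, φ₂, …, ψₙ`, with `k = ⌈j/2⌉` existential quantifiers after `z₀`. -/
def DeltaJ (φ ψ : ℕ → ℝ → Prop) (j : ℕ) (x y : ℝ) : Prop :=
  ∃ z : ℕ → ℝ, z 0 = x ∧ z ((j + 1) / 2) = y ∧ (∀ i < (j + 1) / 2, z i < z (i + 1)) ∧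
    (∀ i, 0 < i → i ≤ j / 2 → φ i (z i)) ∧
    (∀ i, 0 < i → i ≤ (j + 1) / 2 → ∀ u, z (i - 1) < u → u < z i → ψ i u)

/-- The three kinds of formulas in the separation lemma, for the constant `c`:
`◇_{{N}} θ` with `pr θ < N - c`; `◇⁻_{{N}} θ` with `fr θ < N - c`; and formulas in which
all intervals of temporal operators are bounded. -/
def SepKind (c : ℝ) (χ : MTL K P) : Prop :=
  (∃ (N : ℝ) (hm : N ∈ K) (h0 : 0 < N) (θ : MTL K P),
      χ = MTL.untl MTL.tt θ (MTLI.single N hm h0) ∧ θ.pr < ((N - c : ℝ) : WithTop ℝ)) ∨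
  (∃ (N : ℝ) (hm : N ∈ K) (h0 : 0 < N) (θ : MTL K P),
      χ = MTL.sinc MTL.tt θ (MTLI.single N hm h0) ∧ θ.fr < ((N - c : ℝ) : WithTop ℝ)) ∨
  χ.AllBounded


/-- Unary properties of points of a signal. -/
abbrev Pred : Type := (ℝ → Set ℕ) → ℝ → Prop

/-- Binary relations on points of a signal. -/
abbrev Rel : Type := (ℝ → Set ℕ) → ℝ → ℝ → Prop

/-- A unary property is definable if some `MTL_ℤ+C` formula expresses it. -/
def Definable (A : Pred) : Prop :=
  ∃ ψ : MTLC intZ ℕ, ∀ f r, ψ.sat f r ↔ A f r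

/-- `A` holds at points arbitrarily close to `r` on its right. -/
def AccRight (A : Pred) : Pred := fun f r => ∀ t, r < t → ∃ u, r < u ∧ u < t ∧ A f u

/-- `A` holds at points arbitrarily close to `r` on its left. -/
def AccLeft (A : Pred) : Pred := fun f r => ∀ t, t < r → ∃ u, t < u ∧ u < r ∧ A f u

namespace Definable

variable {A B : Pred}

theorem congr (hA : Definable A) (h : ∀ f r, A f r ↔ B f r) : Definable B := by
  obtain ⟨ψ, hψ⟩ := hA
  exact ⟨ψ, fun f r => (hψ f r).trans (h f r)⟩

theorem atom (p : ℕ) : Definable fun f r => p ∈ f r := ⟨.atom p, fun _ _ => Iff.rfl⟩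

theorem tt : Definable fun _ _ => True := ⟨.tt, fun _ _ => Iff.rfl⟩

theorem neg (hA : Definable A) : Definable fun f r => ¬ A f r := by
  obtain ⟨ψ, hψ⟩ := hA
  exact ⟨.neg ψ, fun f r => not_congr (hψ f r)⟩

theorem and (hA : Definable A) (hB : Definable B) : Definable fun f r => A f r ∧ B f r := by
  obtain ⟨φ, hφ⟩ := hA
  obtain ⟨ψ, hψ⟩ := hB
  exact ⟨.conj φ ψ, fun f r => and_congr (hφ f r) (hψ f r)⟩

theorem or (hA : Definable A) (hB : Definable B) : Definable fun f r => A f r ∨ B f r :=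
  (hA.neg.and hB.neg).neg.congr fun _ _ => by tauto

theorem ff : Definable fun _ _ => False := tt.neg.congr fun _ _ => by simp

theorem untl (hA : Definable A) (hB : Definable B) :
    Definable fun f r => ∃ t, r < t ∧ (∀ u, r < u → u < t → A f u) ∧ B f t := by
  obtain ⟨φ, hφ⟩ := hA
  obtain ⟨ψ, hψ⟩ := hB
  refine ⟨.untl φ ψ MTLI.full, fun f r => exists_congr fun t => ?_⟩
  simp only [MTLI.mem, MTLI.full, hφ, hψ]
  constructor
  · rintro ⟨h, -, h1, h2⟩
    exact ⟨h, h2, h1⟩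
  · rintro ⟨h, h2, h1⟩
    exact ⟨h, by simpa using h, h1, h2⟩

theorem sinc (hA : Definable A) (hB : Definable B) :
    Definable fun f r => ∃ t, t < r ∧ (∀ u, t < u → u < r → A f u) ∧ B f t := by
  obtain ⟨φ, hφ⟩ := hA
  obtain ⟨ψ, hψ⟩ := hB
  refine ⟨.sinc φ ψ MTLI.full, fun f r => exists_congr fun t => ?_⟩
  simp only [MTLI.mem, MTLI.full, hφ, hψ]
  constructor
  · rintro ⟨h, -, h1, h2⟩
    exact ⟨h, h2, h1⟩
  · rintro ⟨h, h2, h1⟩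
    exact ⟨h, by simpa using h, h1, h2⟩

theorem intCast_mem_intZ (n : ℤ) : (n : ℝ) ∈ intZ :=
  AddSubgroup.mem_zmultiples_iff.2 ⟨n, by simp⟩

theorem shift (hA : Definable A) (n : ℤ) : Definable fun f r => A f (r + n) := by
  obtain ⟨φ, hφ⟩ := hA
  rcases lt_trichotomy n 0 with hn | rfl | hn
  · have h0 : (0 : ℝ) < ((-n : ℤ) : ℝ) := by exact_mod_cast neg_pos.2 hn
    refine ⟨.sinc .tt φ (MTLI.single ((-n : ℤ) : ℝ) (intCast_mem_intZ _) h0), fun f r => ?_⟩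
    simp only [MTLC.sat, MTLI.mem, MTLI.single, hφ]
    push_cast at h0 ⊢
    constructor
    · rintro ⟨t, -, ⟨h1, h2⟩, h3, -⟩
      have h2 := h2 _ rfl
      have : t = r + n := by linarith
      exact this ▸ h3
    · intro h
      refine ⟨r + n, by linarith, ⟨by simp, fun h hh => ?_⟩, h, fun _ _ _ => trivial⟩
      obtain rfl := Option.some.inj hh
      simp
  · exact ⟨φ, fun f r => by simpa using hφ f r⟩
  · have h0 : (0 : ℝ) < (n : ℝ) := by exact_mod_cast hn
    refine ⟨.untl .tt φ (MTLI.single (n : ℝ) (intCast_mem_intZ _) h0), fun f r => ?_⟩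
    simp only [MTLC.sat, MTLI.mem, MTLI.single, hφ]
    constructor
    · rintro ⟨t, -, ⟨h1, h2⟩, h3, -⟩
      have h2 := h2 _ rfl
      simp only [if_true] at h1 h2
      have : t = r + n := by linarith
      exact this ▸ h3
    · intro h
      refine ⟨r + n, by linarith, ⟨by simp, fun h hh => ?_⟩, h, fun _ _ _ => trivial⟩
      obtain rfl := Option.some.inj hh
      simp

theorem fcount (hA : Definable A) (n : ℕ) : Definable fun f r =>
    ∃ s : Fin n → ℝ, StrictMono s ∧ ∀ i, s i ∈ Set.Ioo r (r + 1) ∧ A f (s i) := by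
  obtain ⟨φ, hφ⟩ := hA
  exact ⟨.fcount n φ, fun f r => by simp only [MTLC.sat, hφ]⟩

theorem accRight (hA : Definable A) : Definable (AccRight A) :=
  (hA.neg.untl tt).neg.congr fun f r => by
    unfold AccRight
    push Not
    refine forall₂_congr fun t _ => ?_
    simp only [imp_false, not_forall, not_not, exists_prop]

theorem accLeft (hA : Definable A) : Definable (AccLeft A) :=
  (hA.neg.sinc tt).neg.congr fun f r => by
    unfold AccLeft
    push Not
    refine forall₂_congr fun t _ => ?_
    simp only [imp_false, not_forall, not_not, exists_prop]

end Definable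

/-- `Pat As` holds at `(x, y)` if the predicates in the list `As`, read from right to left, hold
at increasing points strictly between `x` and `y`. -/
def Pat : List Pred → Rel
  | [] => fun _ x y => x < y
  | A :: As => fun f x y => ∃ z, z < y ∧ Pat As f x z ∧ A f z

namespace Pat

variable {As : List Pred} {f : ℝ → Set ℕ} {x x' y y' : ℝ}

theorem lt (h : Pat As f x y) : x < y := by
  induction As generalizing y with
  | nil => exact h
  | cons A As ih =>
    obtain ⟨z, hz, h, -⟩ := h
    exact (ih h).trans hz

theorem mono_right (h : Pat As f x y) (hy : y ≤ y') : Pat As f x y' := by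
  cases As with
  | nil => exact lt_of_lt_of_le h hy
  | cons A As =>
    obtain ⟨z, hz, h⟩ := h
    exact ⟨z, hz.trans_le hy, h⟩

theorem mono_left (h : Pat As f x y) (hx : x' ≤ x) : Pat As f x' y := by
  induction As generalizing y with
  | nil => exact lt_of_le_of_lt hx h
  | cons A As ih =>
    obtain ⟨z, hz, h, hA⟩ := h
    exact ⟨z, hz, ih h, hA⟩

theorem left_open (h : Pat As f x y) : ∃ y', y' < y ∧ Pat As f x y' := by
  cases As with
  | nil =>
    obtain ⟨z, h1, h2⟩ := exists_between (show x < y from h)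
    exact ⟨z, h2, h1⟩
  | cons A As =>
    obtain ⟨z, hz, h⟩ := h
    obtain ⟨w, h1, h2⟩ := exists_between hz
    exact ⟨w, h2, z, h1, h⟩

theorem append_singleton {A : Pred} :
    Pat (As ++ [A]) f x y ↔ ∃ z, x < z ∧ A f z ∧ Pat As f z y := by
  induction As generalizing y with
  | nil =>
    simp only [List.nil_append, Pat]
    exact exists_congr fun z => by tauto
  | cons B As ih =>
    simp only [List.cons_append, Pat, ih]
    constructor
    · rintro ⟨z, h1, ⟨w, h2, h3, h4⟩, h5⟩
      exact ⟨w, h2, h3, z, h1, h4, h5⟩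
    · rintro ⟨w, h2, h3, z, h1, h4, h5⟩
      exact ⟨z, h1, ⟨w, h2, h3, h4⟩, h5⟩

theorem replicate_iff (A : Pred) (n : ℕ) (hxy : x < y) : Pat (List.replicate n A) f x y ↔
    ∃ s : Fin n → ℝ, StrictMono s ∧ ∀ i, s i ∈ Set.Ioo x y ∧ A f (s i) := by
  induction n generalizing x with
  | zero => exact ⟨fun _ => ⟨Fin.elim0, fun i => i.elim0, fun i => i.elim0⟩, fun _ => hxy⟩
  | succ n ih =>
    rw [List.replicate_succ', append_singleton]
    constructor
    · rintro ⟨z, hz, hA, h⟩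
      obtain ⟨s, hs, h1⟩ := (ih h.lt).1 h
      refine ⟨Fin.cons z s, ?_, ?_⟩
      · refine Fin.strictMono_iff_lt_succ.2 fun i => ?_
        cases n with
        | zero => exact i.elim0
        | succ n =>
          refine Fin.cases ?_ (fun j => ?_) i
          · simpa using (h1 0).1.1
          · have := hs (Fin.castSucc_lt_succ (i := j))
            simpa [Fin.castSucc_succ] using this
      · refine Fin.cases ?_ (fun j => ?_)
        · simpa using ⟨⟨hz, h.lt⟩, hA⟩
        · simpa using ⟨⟨hz.trans (h1 j).1.1, (h1 j).1.2⟩, (h1 j).2⟩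
    · rintro ⟨s, hs, h1⟩
      refine ⟨s 0, (h1 0).1.1, (h1 0).2, (ih (h1 0).1.2).2 ⟨fun i => s i.succ, ?_, ?_⟩⟩
      · exact fun i j hij => hs (Fin.succ_lt_succ_iff.2 hij)
      · exact fun i => ⟨⟨hs (Fin.succ_pos i), (h1 _).1.2⟩, (h1 _).2⟩

end Pat

/-- Relations asserting a chain of points between two endpoints, with definable conditions at the
points and on the gaps between them. -/
inductive Chain : Rel → Prop
  | base {L B R : Pred} : Definable L → Definable B → Definable R →
      Chain fun f x y => L f x ∧ (∀ u, x < u → u < y → B f u) ∧ R f y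
  | snoc {C : Rel} {B R : Pred} : Chain C → Definable B → Definable R →
      Chain fun f x y => ∃ z, x < z ∧ z < y ∧ C f x z ∧ (∀ u, z < u → u < y → B f u) ∧ R f y

/-- Relations that agree, on pairs `x < y`, with a finite disjunction of chains. -/
inductive Chains : Rel → Prop
  | chain {R : Rel} : Chain R → Chains R
  | bot : Chains fun _ _ _ => False
  | or {R S : Rel} : Chains R → Chains S → Chains fun f x y => R f x y ∨ S f x y
  | congr {R S : Rel} : Chains R → (∀ f x y, x < y → (R f x y ↔ S f x y)) → Chains S

namespace Chains

variable {A B L : Pred} {R S : Rel}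

theorem left (hA : Definable A) : Chains fun f x _ => A f x :=
  (chain (.base hA .tt .tt)).congr fun _ _ _ _ => by simp

theorem right (hA : Definable A) : Chains fun f _ y => A f y :=
  (chain (.base .tt .tt hA)).congr fun _ _ _ _ => by simp

theorem box (hA : Definable A) : Chains fun f x y => ∀ u, x < u → u < y → A f u :=
  (chain (.base .tt hA .tt)).congr fun _ _ _ _ => by simp

theorem tt : Chains fun _ _ _ => True := left .tt

theorem snoc (hR : Chains R) (hB : Definable B) (hA : Definable A) :
    Chains fun f x y => ∃ z, x < z ∧ z < y ∧ R f x z ∧ (∀ u, z < u → u < y → B f u) ∧ A f y := by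
  induction hR with
  | chain h => exact chain (.snoc h hB hA)
  | bot => exact bot.congr fun _ _ _ _ => by simp
  | or _ _ ih1 ih2 =>
    refine (ih1.or ih2).congr fun f x y _ => ?_
    simp only [or_and_right, and_or_left, exists_or]
  | congr _ h ih =>
    refine ih.congr fun f x y _ => exists_congr fun z => ?_
    exact and_congr_right fun hz => and_congr_right fun _ => and_congr_left' (h _ _ _ hz)

theorem and_right (hR : Chains R) (hA : Definable A) :
    Chains fun f x y => R f x y ∧ A f y := by
  induction hR with
  | chain h =>
    cases h with
    | base h1 h2 h3 => exact (chain (.base h1 h2 (h3.and hA))).congr fun _ _ _ _ => by tauto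
    | snoc h1 h2 h3 =>
      refine (chain (.snoc h1 h2 (h3.and hA))).congr fun f x y _ => ?_
      rw [← exists_and_right]
      exact exists_congr fun z => by tauto
  | bot => exact bot.congr fun _ _ _ _ => by simp
  | or _ _ ih1 ih2 => exact (ih1.or ih2).congr fun f x y _ => by tauto
  | congr _ h ih => exact ih.congr fun f x y hxy => by rw [h f x y hxy]

theorem base_and (hL : Definable L) (hB : Definable B) (hR : Chain R) : ∀ {A}, Definable A →
    Chains fun f x y => (L f x ∧ (∀ u, x < u → u < y → B f u) ∧ A f y) ∧ R f x y := by
  induction hR with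
  | base h1 h2 h3 =>
    intro A hA
    refine (chain (.base (hL.and h1) (hB.and h2) (hA.and h3))).congr fun f x y _ => ?_
    simp only [imp_and, forall_and]
    tauto
  | snoc hC hB' hR' ih =>
    intro A hA
    refine ((ih hB).snoc (hB.and hB') (hA.and hR')).congr fun f x y _ => ?_
    constructor
    · rintro ⟨z, h1, h2, ⟨⟨h3, h4, h5⟩, h6⟩, h7, h8, h9⟩
      refine ⟨⟨h3, fun u hu hu' => ?_, h8⟩, z, h1, h2, h6, fun u hu hu' => (h7 u hu hu').2, h9⟩
      rcases lt_trichotomy u z with h | rfl | h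
      · exact h4 u hu h
      · exact h5
      · exact (h7 u h hu').1
    · rintro ⟨⟨h3, h4, h8⟩, z, h1, h2, h6, h7, h9⟩
      exact ⟨z, h1, h2, ⟨⟨h3, fun u hu hu' => h4 u hu (hu'.trans h2), h4 z h1 h2⟩, h6⟩,
        fun u hu hu' => ⟨h4 u (h1.trans hu) hu', h7 u hu hu'⟩, h8, h9⟩

theorem chain_and (hR : Chain R) :
    ∀ {S}, Chain S → Chains fun f x y => R f x y ∧ S f x y := by
  induction hR with
  | base h1 h2 h3 => exact fun hS => base_and h1 h2 hS h3
  | @snoc C B R hC hB hR ih =>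
    intro S hS
    induction hS generalizing R with
    | base h1 h2 h3 =>
      exact (base_and h1 h2 (.snoc hC hB hR) h3).congr fun f x y _ => and_comm
    | @snoc C' B' R' hC' hB' hR' ih' =>
      refine ((((ih' hB).snoc (hB.and hB') (hR.and hR')).or
        ((ih hC').snoc (hB.and hB') (hR.and hR'))).or
        ((ih (.snoc hC' hB' hB')).snoc (hB.and hB') (hR.and hR'))).congr fun f x y _ => ?_
      constructor
      · rintro ((⟨z', h1, h2, ⟨⟨z, h3, h4, h5, h6, h7⟩, h8⟩, h9, h10, h11⟩ |
          ⟨z, h1, h2, ⟨h3, h4⟩, h9, h10, h11⟩) |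
          ⟨z, h1, h2, ⟨h8, ⟨z', h3, h4, h5, h6, h7⟩⟩, h9, h10, h11⟩)
        · refine ⟨⟨z, h3, h4.trans h2, h5, fun u hu hu' => ?_, h10⟩, z', h1, h2, h8,
            fun u hu hu' => (h9 u hu hu').2, h11⟩
          rcases lt_trichotomy u z' with h | rfl | h
          · exact h6 u hu h
          · exact h7
          · exact (h9 u h hu').1
        · exact ⟨⟨z, h1, h2, h3, fun u hu hu' => (h9 u hu hu').1, h10⟩,
            z, h1, h2, h4, fun u hu hu' => (h9 u hu hu').2, h11⟩
        · refine ⟨⟨z, h1, h2, h8, fun u hu hu' => (h9 u hu hu').1, h10⟩, z', h3, h4.trans h2, h5,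
            fun u hu hu' => ?_, h11⟩
          rcases lt_trichotomy u z with h | rfl | h
          · exact h6 u hu h
          · exact h7
          · exact (h9 u h hu').2
      · rintro ⟨⟨z, h1, h2, h3, h4, h5⟩, z', h1', h2', h3', h4', h5'⟩
        rcases lt_trichotomy z z' with h | rfl | h
        · exact Or.inl (Or.inl ⟨z', h1', h2', ⟨⟨z, h1, h, h3,
            fun u hu hu' => h4 u hu (hu'.trans h2'), h4 z' h h2'⟩, h3'⟩,
            fun u hu hu' => ⟨h4 u (h.trans hu) hu', h4' u hu hu'⟩, h5, h5'⟩)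
        · exact Or.inl (Or.inr ⟨z, h1, h2, ⟨h3, h3'⟩,
            fun u hu hu' => ⟨h4 u hu hu', h4' u hu hu'⟩, h5, h5'⟩)
        · exact Or.inr ⟨z, h1, h2, ⟨h3, ⟨z', h1', h, h3', fun u hu hu' => h4' u hu (hu'.trans h2),
            h4' z h h2⟩⟩, fun u hu hu' => ⟨h4 u hu hu', h4' u (h.trans hu) hu'⟩, h5, h5'⟩

theorem and (hR : Chains R) (hS : Chains S) : Chains fun f x y => R f x y ∧ S f x y := by
  induction hR with
  | chain h =>
    induction hS with
    | chain h' => exact chain_and h h'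
    | bot => exact bot.congr fun _ _ _ _ => by simp
    | or _ _ ih1 ih2 => exact (ih1.or ih2).congr fun f x y _ => by tauto
    | congr _ h ih => exact ih.congr fun f x y hxy => by rw [h f x y hxy]
  | bot => exact bot.congr fun _ _ _ _ => by simp
  | or _ _ ih1 ih2 => exact (ih1.or ih2).congr fun f x y _ => by tauto
  | congr _ h ih => exact ih.congr fun f x y hxy => by rw [h f x y hxy]

/-- Looking forward along a chain is definable. -/
theorem definable_exists_right (hR : Chains R) :
    ∀ {A}, Definable A → Definable fun f x => ∃ y, x < y ∧ R f x y ∧ A f y := by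
  induction hR with
  | chain h =>
    induction h with
    | base h1 h2 h3 =>
      intro A hA
      refine (h1.and (h2.untl (h3.and hA))).congr fun f x => ?_
      rw [← exists_and_left]
      exact exists_congr fun z => by tauto
    | snoc _ h2 h3 ih =>
      intro A hA
      refine (ih (h2.untl (h3.and hA))).congr fun f x => ?_
      constructor
      · rintro ⟨z, h1, h2, y, h3, h4, h5, h6⟩
        exact ⟨y, h1.trans h3, ⟨z, h1, h3, h2, h4, h5⟩, h6⟩
      · rintro ⟨y, -, ⟨z, h1, h3, h2, h4, h5⟩, h6⟩
        exact ⟨z, h1, h2, y, h3, h4, h5, h6⟩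
  | bot => exact fun _ => Definable.ff.congr fun _ _ => by simp
  | or _ _ ih1 ih2 =>
    refine fun hA => ((ih1 hA).or (ih2 hA)).congr fun f x => ?_
    rw [← exists_or]
    exact exists_congr fun z => by tauto
  | congr _ h ih =>
    refine fun hA => (ih hA).congr fun f x => exists_congr fun y => ?_
    exact and_congr_right fun hxy => by rw [h f x y hxy]

/-- Looking backward along a chain is definable. -/
theorem definable_exists_left (hR : Chains R) (hA : Definable A) :
    Definable fun f y => ∃ x, x < y ∧ A f x ∧ R f x y := by
  induction hR with
  | chain h =>
    induction h with
    | base h1 h2 h3 =>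
      refine (h3.and (h2.sinc (h1.and hA))).congr fun f x => ?_
      rw [← exists_and_left]
      exact exists_congr fun z => by tauto
    | snoc _ h2 h3 ih =>
      refine (h3.and (h2.sinc ih)).congr fun f y => ?_
      constructor
      · rintro ⟨h1, z, h2, h3, x, h4, h5, h6⟩
        exact ⟨x, h4.trans h2, h5, z, h4, h2, h6, h3, h1⟩
      · rintro ⟨x, -, h5, z, h4, h2, h6, h3, h1⟩
        exact ⟨h1, z, h2, h3, x, h4, h5, h6⟩
  | bot => exact Definable.ff.congr fun _ _ => by simp
  | or _ _ ih1 ih2 =>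
    refine (ih1.or ih2).congr fun f x => ?_
    rw [← exists_or]
    exact exists_congr fun z => by tauto
  | congr _ h ih =>
    refine ih.congr fun f y => exists_congr fun x => ?_
    exact and_congr_right fun hxy => by rw [h f x y hxy]

end Chains

theorem accLeft_or_exists_last {A : Pred} {f : ℝ → Set ℕ} {x y : ℝ}
    (h : ∃ u, x < u ∧ u < y ∧ A f u) :
    AccLeft A f y ∨
      ∃ r, x < r ∧ r < y ∧ (A f r ∨ AccLeft A f r) ∧ ∀ u, r < u → u < y → ¬ A f u := by
  set S : Set ℝ := {u | x < u ∧ u < y ∧ A f u} with hS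
  have hne : S.Nonempty := h
  have hb : BddAbove S := ⟨y, fun u hu => hu.2.1.le⟩
  have hle : sSup S ≤ y := csSup_le hne fun u hu => hu.2.1.le
  have hx : x < sSup S := by
    obtain ⟨u, hu⟩ := h
    exact hu.1.trans_le (le_csSup hb hu)
  have hacc : A f (sSup S) ∨ AccLeft A f (sSup S) := by
    by_cases hA : A f (sSup S)
    · exact .inl hA
    refine .inr fun t ht => ?_
    obtain ⟨u, hu, htu⟩ := exists_lt_of_lt_csSup hne ht
    refine ⟨u, htu, lt_of_le_of_ne (le_csSup hb hu) ?_, hu.2.2⟩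
    rintro rfl
    exact hA hu.2.2
  rcases hle.lt_or_eq with hlt | heq
  · exact .inr ⟨_, hx, hlt, hacc, fun u h1 h2 h3 =>
      absurd (le_csSup hb ⟨hx.trans h1, h2, h3⟩) (not_le.2 h1)⟩
  · refine .inl fun t ht => ?_
    obtain ⟨u, hu, htu⟩ := exists_lt_of_lt_csSup hne (heq ▸ ht)
    exact ⟨u, htu, hu.2.1, hu.2.2⟩

namespace Chains

theorem pat {As : List Pred} (h : ∀ A ∈ As, Definable A) : Chains (Pat As) := by
  induction As with
  | nil => exact tt.congr fun f x y hxy => by simpa [Pat] using hxy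
  | cons A As ih =>
    refine (((ih fun B hB => h B (by simp [hB])).and_right (h A (by simp))).snoc .tt .tt).congr
      fun f x y _ => exists_congr fun z => ?_
    simp only [implies_true, and_true]
    exact ⟨fun h => h.2, fun h => ⟨h.2.1.lt, h⟩⟩

theorem not_pat {As : List Pred} (h : ∀ A ∈ As, Definable A) :
    Chains fun f x y => ¬ Pat As f x y := by
  induction As with
  | nil => exact bot.congr fun f x y hxy => by simpa [Pat] using hxy
  | cons A As ih =>
    have hA := h A (by simp)
    have hn := ih fun B hB => h B (by simp [hB])
    refine (((box hA.neg).or (hn.and_right hA.accLeft)).or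
      ((hn.and_right (hA.or hA.accLeft)).snoc hA.neg .tt)).congr fun f x y hxy => ?_
    simp only [and_true]
    constructor
    · rintro ((h1 | ⟨h1, -⟩) | ⟨r, -, -, ⟨h1, -⟩, h2⟩) ⟨z, h3, h4, h5⟩
      · exact h1 z h4.lt h3 h5
      · exact h1 (h4.mono_right h3.le)
      · rcases le_or_gt z r with hz | hz
        · exact h1 (h4.mono_right hz)
        · exact h2 z hz h3 h5
    · intro hP
      have key : ∀ r, r ≤ y → AccLeft A f r → ¬ Pat As f x r := fun r hr hacc hp => by
        obtain ⟨y', hy', hp'⟩ := hp.left_open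
        obtain ⟨u, h1, h2, h3⟩ := hacc y' hy'
        exact hP ⟨u, h2.trans_le hr, hp'.mono_right h1.le, h3⟩
      by_cases hex : ∃ u, x < u ∧ u < y ∧ A f u
      · rcases accLeft_or_exists_last hex with hacc | ⟨r, h1, h2, h3, h4⟩
        · exact .inl (.inr ⟨key y le_rfl hacc, hacc⟩)
        · refine .inr ⟨r, h1, h2, ⟨?_, h3⟩, h4⟩
          rcases h3 with h3 | h3
          · exact fun hp => hP ⟨r, h2, hp, h3⟩
          · exact key r h2.le h3
      · exact .inl (.inl fun u h1 h2 h3 => hex ⟨u, h1, h2, h3⟩)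

end Chains

/-- Boolean combinations of endpoint conditions and patterns, up to agreement on pairs
`x < y`. -/
inductive PatBool : Rel → Prop
  | left {A : Pred} : Definable A → PatBool fun f x _ => A f x
  | right {A : Pred} : Definable A → PatBool fun f _ y => A f y
  | pat {As : List Pred} : (∀ A ∈ As, Definable A) → PatBool (Pat As)
  | neg {R : Rel} : PatBool R → PatBool fun f x y => ¬ R f x y
  | and {R S : Rel} : PatBool R → PatBool S → PatBool fun f x y => R f x y ∧ S f x y
  | congr {R S : Rel} : PatBool R → (∀ f x y, x < y → (R f x y ↔ S f x y)) → PatBool S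

namespace PatBool

variable {R S : Rel}

theorem chains_and_not (hR : PatBool R) : Chains R ∧ Chains fun f x y => ¬ R f x y := by
  induction hR with
  | left hA => exact ⟨.left hA, .left hA.neg⟩
  | right hA => exact ⟨.right hA, .right hA.neg⟩
  | pat h => exact ⟨.pat h, .not_pat h⟩
  | neg _ ih => exact ⟨ih.2, ih.1.congr fun _ _ _ _ => not_not.symm⟩
  | and _ _ ih1 ih2 => exact ⟨ih1.1.and ih2.1, (ih1.2.or ih2.2).congr fun _ _ _ _ => by tauto⟩
  | congr _ h ih =>
    exact ⟨ih.1.congr h, ih.2.congr fun f x y hxy => not_congr (h f x y hxy)⟩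

theorem chains (hR : PatBool R) : Chains R := hR.chains_and_not.1

theorem or (hR : PatBool R) (hS : PatBool S) : PatBool fun f x y => R f x y ∨ S f x y :=
  (hR.neg.and hS.neg).neg.congr fun _ _ _ _ => by tauto

theorem ff : PatBool fun _ _ _ => False := left .ff

theorem box {B : Pred} (hB : Definable B) : PatBool fun f x y => ∀ u, x < u → u < y → B f u :=
  (pat (As := [fun f u => ¬ B f u]) (by simpa using hB.neg)).neg.congr fun f x y _ => by
    simp only [Pat, not_exists, not_and, not_not]
    exact forall_congr' fun u => forall_comm

theorem exists_finite {ι : Type} [Finite ι] {T : ι → Rel} (h : ∀ i, PatBool (T i)) :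
    PatBool fun f x y => ∃ i, T i f x y := by
  classical
  cases nonempty_fintype ι
  have : ∀ s : Finset ι, PatBool fun f x y => ∃ i ∈ s, T i f x y := fun s => by
    induction s using Finset.induction_on with
    | empty => exact ff.congr fun _ _ _ _ => by simp
    | insert i s _ ih => exact ((h i).or ih).congr fun _ _ _ _ => by simp
  exact (this Finset.univ).congr fun _ _ _ _ => by simp

theorem forall_finite {ι : Type} [Finite ι] {T : ι → Rel} (h : ∀ i, PatBool (T i)) :
    PatBool fun f x y => ∀ i, T i f x y :=
  (exists_finite fun i => (h i).neg).neg.congr fun _ _ _ _ => by simp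

end PatBool

theorem exists_box_and_pat_iff {B G : Pred} {Fs : List Pred} {f : ℝ → Set ℕ} {x y : ℝ} :
    (∃ z, x < z ∧ (∀ u, x < u → u < z → B f u) ∧ G f z ∧ Pat Fs f z y) ↔
      (∃ z, x < z ∧ (∀ u, x < u → u < z → B f u) ∧ G f z) ∧ Pat (Fs ++ [G]) f x y := by
  rw [Pat.append_singleton]
  constructor
  · rintro ⟨z, h1, h2, h3, h4⟩
    exact ⟨⟨z, h1, h2, h3⟩, z, h1, h3, h4⟩
  · rintro ⟨⟨z, h1, h2, h3⟩, w, h4, h5, h6⟩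
    rcases le_or_gt z w with h | h
    · exact ⟨z, h1, h2, h3, h6.mono_left h⟩
    · exact ⟨w, h4, fun u hu hu' => h2 u hu (hu'.trans h), h5, h6⟩

theorem Chain.exists_and_pat {C : Rel} (hC : Chain C) :
    ∀ {G : Pred} {Fs : List Pred}, Definable G → (∀ F ∈ Fs, Definable F) →
      ∃ (A : Pred) (As : List Pred), Definable A ∧ (∀ F ∈ As, Definable F) ∧
        ∀ f x y, (∃ z, x < z ∧ C f x z ∧ G f z ∧ Pat Fs f z y) ↔ A f x ∧ Pat As f x y := by
  induction hC with
  | @base L B R hL hB hR =>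
    intro G Fs hG hFs
    refine ⟨_, Fs ++ [fun f z => R f z ∧ G f z], hL.and (hB.untl (hR.and hG)), ?_,
      fun f x y => ?_⟩
    · intro F hF
      rcases List.mem_append.1 hF with hF | hF
      · exact hFs F hF
      · obtain rfl := List.mem_singleton.1 hF
        exact hR.and hG
    · refine Iff.trans ?_ ((and_congr_right' (exists_box_and_pat_iff (B := B)
        (G := fun f z => R f z ∧ G f z))).trans and_assoc.symm)
      rw [← exists_and_left]
      exact exists_congr fun z => by tauto
  | @snoc C B R _ hB hR ih =>
    intro G Fs hG hFs
    have hl : ∀ F ∈ Fs ++ [fun f z => R f z ∧ G f z], Definable F := fun F hF => by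
      rcases List.mem_append.1 hF with hF | hF
      · exact hFs F hF
      · obtain rfl := List.mem_singleton.1 hF
        exact hR.and hG
    obtain ⟨A, As, hA, hAs, h⟩ := ih (hB.untl (hR.and hG)) hl
    refine ⟨A, As, hA, hAs, fun f x y => ?_⟩
    refine Iff.trans ?_ ((exists_congr fun w => and_congr_right' (and_congr_right'
      (exists_box_and_pat_iff (B := B) (G := fun f z => R f z ∧ G f z)))).trans (h f x y))
    constructor
    · rintro ⟨z, -, ⟨w, h2, h3, h4, h5, h6⟩, h7, h8⟩
      exact ⟨w, h2, h4, z, h3, h5, ⟨h6, h7⟩, h8⟩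
    · rintro ⟨w, h2, h4, z, h3, h5, ⟨h6, h7⟩, h8⟩
      exact ⟨z, h2.trans h3, ⟨w, h2, h3, h4, h5, h6⟩, h7, h8⟩

theorem Chains.patBool_exists {R : Rel} (hR : Chains R) :
    PatBool fun f x y => ∃ u, x < u ∧ u < y ∧ R f x u := by
  induction hR with
  | chain h =>
    obtain ⟨A, As, hA, hAs, h⟩ := h.exists_and_pat (G := fun _ _ => True) (Fs := []) .tt (by simp)
    refine ((PatBool.left hA).and (.pat hAs)).congr fun f x y _ => ?_
    rw [← h]
    exact exists_congr fun z => by simp only [Pat]; tauto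
  | bot => exact PatBool.ff.congr fun _ _ _ _ => by simp
  | or _ _ ih1 ih2 =>
    refine (ih1.or ih2).congr fun f x y _ => ?_
    rw [← exists_or]
    exact exists_congr fun z => by tauto
  | congr _ h ih =>
    exact ih.congr fun f x y _ => exists_congr fun u =>
      and_congr_right fun hu => and_congr_right fun _ => h f x u hu

/-- A flag is a relation that is monotone and left-open in its second argument. -/
structure IsFlag (T : Rel) : Prop where
  patBool : PatBool T
  mono : ∀ {f x y y'}, T f x y → y ≤ y' → T f x y'
  left_open : ∀ {f x y}, x < y → T f x y → ∃ y', x < y' ∧ y' < y ∧ T f x y'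

theorem IsFlag.left {A : Pred} (hA : Definable A) : IsFlag fun f x _ => A f x where
  patBool := .left hA
  mono h _ := h
  left_open hxy h := by
    obtain ⟨z, h1, h2⟩ := exists_between hxy
    exact ⟨z, h1, h2, h⟩

theorem IsFlag.pat {As : List Pred} (h : ∀ A ∈ As, Definable A) : IsFlag (Pat As) where
  patBool := .pat h
  mono := Pat.mono_right
  left_open _ h := by
    obtain ⟨z, h1, h2⟩ := h.left_open
    exact ⟨z, h2.lt, h1, h2⟩

theorem IsFlag.eventually_eq {ι : Type} [Finite ι] {T : ι → Rel} (hT : ∀ i, IsFlag (T i))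
    {f : ℝ → Set ℕ} {x y : ℝ} (hxy : x < y) :
    ∃ y', x < y' ∧ y' < y ∧ {i | T i f x y'} = {i | T i f x y} := by
  classical
  cases nonempty_fintype ι
  have : ∀ s : Finset ι, ∃ y', x < y' ∧ y' < y ∧ ∀ i ∈ s, T i f x y → T i f x y' := fun s => by
    induction s using Finset.induction_on with
    | empty =>
      obtain ⟨z, h1, h2⟩ := exists_between hxy
      exact ⟨z, h1, h2, by simp⟩
    | insert i s _ ih =>
      obtain ⟨z, h1, h2, h3⟩ := ih
      by_cases hi : T i f x y
      · obtain ⟨w, h4, h5, h6⟩ := (hT i).left_open hxy hi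
        refine ⟨max z w, lt_max_of_lt_left h1, max_lt h2 h5, fun j hj hjy => ?_⟩
        rcases Finset.mem_insert.1 hj with rfl | hj
        · exact (hT j).mono h6 (le_max_right _ _)
        · exact (hT j).mono (h3 j hj hjy) (le_max_left _ _)
      · refine ⟨z, h1, h2, fun j hj hjy => ?_⟩
        rcases Finset.mem_insert.1 hj with rfl | hj
        · exact absurd hjy hi
        · exact h3 j hj hjy
  obtain ⟨z, h1, h2, h3⟩ := this Finset.univ
  exact ⟨z, h1, h2, Set.ext fun i => ⟨fun h => (hT i).mono h h2.le, h3 i (Finset.mem_univ i)⟩⟩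

theorem IsFlag.patBool_eq {ι : Type} [Finite ι] {T : ι → Rel} (hT : ∀ i, IsFlag (T i))
    (σ : Set ι) : PatBool fun f x y => {i | T i f x y} = σ := by
  classical
  have : PatBool fun f x y => ∀ i, (T i f x y ↔ i ∈ σ) := by
    refine PatBool.forall_finite fun i => ?_
    by_cases hi : i ∈ σ
    · exact (hT i).patBool.congr fun _ _ _ _ => by simp [hi]
    · exact (hT i).patBool.neg.congr fun _ _ _ _ => by simp [hi]
  exact this.congr fun f x y _ => by simp [Set.ext_iff]

theorem PatBool.normalForm {R : Rel} (hR : PatBool R) :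
    ∃ (ι : Type) (_ : Finite ι) (T : ι → Rel) (B : Set ι → Pred), (∀ i, IsFlag (T i)) ∧
      (∀ σ, Definable (B σ)) ∧ ∀ f x y, x < y → (R f x y ↔ B {i | T i f x y} f y) := by
  classical
  have flag : ∀ T : Rel, IsFlag T → ∃ (ι : Type) (_ : Finite ι) (T' : ι → Rel)
      (B : Set ι → Pred), (∀ i, IsFlag (T' i)) ∧ (∀ σ, Definable (B σ)) ∧
      ∀ f x y, x < y → (T f x y ↔ B {i | T' i f x y} f y) := fun T hT => by
    refine ⟨Unit, inferInstance, fun _ => T, fun σ _ _ => () ∈ σ, fun _ => hT, fun σ => ?_,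
      fun f x y _ => Iff.rfl⟩
    by_cases h : () ∈ σ
    · simpa [h] using Definable.tt
    · simpa [h] using Definable.ff
  induction hR with
  | left hA => exact flag _ (.left hA)
  | right hA =>
    exact ⟨Empty, inferInstance, fun i => i.elim, fun _ => _, fun i => i.elim, fun _ => hA,
      fun f x y _ => Iff.rfl⟩
  | pat h => exact flag _ (.pat h)
  | neg _ ih =>
    obtain ⟨ι, hι, T, B, h1, h2, h3⟩ := ih
    exact ⟨ι, hι, T, fun σ f r => ¬ B σ f r, h1, fun σ => (h2 σ).neg,
      fun f x y hxy => not_congr (h3 f x y hxy)⟩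
  | and _ _ ih1 ih2 =>
    obtain ⟨ι, hι, T, B, h1, h2, h3⟩ := ih1
    obtain ⟨ι', hι', T', B', h1', h2', h3'⟩ := ih2
    refine ⟨ι ⊕ ι', inferInstance, Sum.elim T T',
      fun σ f r => B (Sum.inl ⁻¹' σ) f r ∧ B' (Sum.inr ⁻¹' σ) f r, ?_,
      fun σ => (h2 _).and (h2' _), fun f x y hxy => ?_⟩
    · rintro (i | i)
      · exact h1 i
      · exact h1' i
    · exact and_congr (h3 f x y hxy) (h3' f x y hxy)
  | congr _ h ih =>
    obtain ⟨ι, hι, T, B, h1, h2, h3⟩ := ih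
    exact ⟨ι, hι, T, B, h1, h2, fun f x y hxy => (h f x y hxy).symm.trans (h3 f x y hxy)⟩

theorem PatBool.snoc_box {R : Rel} {B : Pred} (hR : PatBool R) (hB : Definable B) :
    PatBool fun f x y => ∃ z, x < z ∧ z < y ∧ R f x z ∧ ∀ u, z < u → u < y → B f u := by
  obtain ⟨ι, hι, T, D, hT, hD, h⟩ := hR.normalForm
  have hS : Chains fun f x y => ∃ z, x < z ∧ z < y ∧ R f x z ∧ ∀ u, z < u → u < y → B f u :=
    (hR.chains.snoc hB .tt).congr fun f x y _ => by simp
  have hσ := fun σ => IsFlag.patBool_eq hT σ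
  have h1 := fun σ : Set ι =>
    ((hσ σ).chains.and_right ((hD σ).or hB.neg)).patBool_exists
  have h2 := fun σ : Set ι => ((hσ σ).chains.and hS).patBool_exists
  refine (PatBool.exists_finite fun σ => (hσ σ).and (((h1 σ).and (.right (hB.sinc (hD σ)))).or
    ((h1 σ).neg.and (h2 σ)))).congr fun f x y hxy => ?_
  have mono : ∀ {u v}, u ≤ v → {i | T i f x u} ⊆ {i | T i f x v} :=
    fun huv i hi => (hT i).mono hi huv
  rw [exists_eq_left']
  constructor
  · rintro (⟨⟨u, hu, huy, heq, hu'⟩, t, hty, ht, hDt⟩ | ⟨hn, u, hu, huy, heq, z, hz, hzu, hR, hBz⟩)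
    · rcases lt_or_ge t u with htu | htu
      · have := hu'.resolve_right (not_not.2 (ht u htu huy))
        exact ⟨u, hu, huy, (h f x u hu).2 (heq ▸ this),
          fun w hw hwy => ht w (htu.trans hw) hwy⟩
      · have heq' : {i | T i f x t} = {i | T i f x y} :=
          (mono hty.le).antisymm (heq ▸ mono htu)
        exact ⟨t, hu.trans_le htu, hty, (h f x t (hu.trans_le htu)).2 (heq' ▸ hDt), ht⟩
    · refine ⟨z, hz, hzu.trans huy, hR, fun w hw hwy => ?_⟩
      rcases lt_or_ge w u with hwu | hwu
      · exact hBz w hw hwu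
      · by_contra hBw
        exact hn ⟨w, hu.trans_le hwu, hwy, (mono hwy.le).antisymm (heq ▸ mono hwu), .inr hBw⟩
  · rintro ⟨z, hz, hzy, hR, hBz⟩
    have hDz := (h f x z hz).1 hR
    by_cases hFl : ∃ u, x < u ∧ u < y ∧ {i | T i f x u} = {i | T i f x y} ∧
        (D {i | T i f x y} f u ∨ ¬ B f u)
    · refine .inl ⟨hFl, ?_⟩
      obtain ⟨u, hu, huy, heq, hu'⟩ := hFl
      by_cases hzeq : {i | T i f x z} = {i | T i f x y}
      · exact ⟨z, hzy, hBz, hzeq ▸ hDz⟩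
      · have hzu : z < u := by
          by_contra! hc
          exact hzeq ((mono hzy.le).antisymm (heq ▸ mono hc))
        exact ⟨u, huy, fun w hw hwy => hBz w (hzu.trans hw) hwy,
          hu'.resolve_right (not_not.2 (hBz u hzu huy))⟩
    · refine .inr ⟨hFl, ?_⟩
      have hzeq : {i | T i f x z} ≠ {i | T i f x y} := fun hc =>
        hFl ⟨z, hz, hzy, hc, .inl (hc ▸ hDz)⟩
      obtain ⟨u, hu, huy, heq⟩ := IsFlag.eventually_eq hT (f := f) hxy
      have hzu : z < u := by
        by_contra! hc
        exact hzeq ((mono hzy.le).antisymm (heq ▸ mono hc))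
      exact ⟨u, hu, huy, heq, z, hz, hzu, hR, fun w hw hwu => hBz w hw (hwu.trans huy)⟩

theorem Chains.patBool {R : Rel} (hR : Chains R) : PatBool R := by
  induction hR with
  | chain h =>
    induction h with
    | base hL hB hR => exact (PatBool.left hL).and ((PatBool.box hB).and (.right hR))
    | snoc _ hB hR ih =>
      refine ((ih.snoc_box hB).and (.right hR)).congr fun f x y _ => ?_
      rw [← exists_and_right]
      exact exists_congr fun z => by tauto
  | bot => exact .ff
  | or _ _ ih1 ih2 => exact ih1.or ih2
  | congr _ h ih => exact ih.congr h

theorem Chains.neg {R : Rel} (hR : Chains R) : Chains fun f x y => ¬ R f x y :=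
  hR.patBool.neg.chains

theorem PatBool.forall_gt_pat {As : List Pred} (h : ∀ A ∈ As, Definable A) :
    PatBool fun f x w => ∀ y, w < y → Pat As f x y := by
  induction As with
  | nil =>
    refine (PatBool.left .tt).congr fun f x w hxw => ?_
    simpa [Pat] using fun y hy => hxw.trans hy
  | cons B As ih =>
    have hB := h B (by simp)
    have h' : ∀ A ∈ As, Definable A := fun A hA => h A (by simp [hA])
    refine ((PatBool.pat h).or (((PatBool.pat h').and (.right hB)).or
      ((PatBool.right hB.accRight).and (ih h')))).congr fun f x w _ => ?_
    constructor
    · rintro (hT | ⟨hp, hBw⟩ | ⟨hacc, hM⟩) y hy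
      · exact hT.mono_right hy.le
      · exact ⟨w, hy, hp, hBw⟩
      · obtain ⟨u, h1, h2, h3⟩ := hacc y hy
        exact ⟨u, h2, hM u h1, h3⟩
    · intro hM
      by_cases h1 : Pat (B :: As) f x w
      · exact .inl h1
      by_cases h2 : Pat As f x w ∧ B f w
      · exact .inr (.inl h2)
      have key : ∀ y, w < y → ∃ z, w < z ∧ z < y ∧ Pat As f x z ∧ B f z := fun y hy => by
        obtain ⟨z, hz, hp, hBz⟩ := hM y hy
        refine ⟨z, ?_, hz, hp, hBz⟩
        rcases lt_trichotomy w z with hc | rfl | hc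
        · exact hc
        · exact absurd ⟨hp, hBz⟩ h2
        · exact absurd ⟨z, hc, hp, hBz⟩ h1
      refine .inr (.inr ⟨fun t ht => ?_, fun y hy => ?_⟩)
      · obtain ⟨z, h3, h4, -, h5⟩ := key t ht
        exact ⟨z, h3, h4, h5⟩
      · obtain ⟨z, -, h4, h5, -⟩ := key y hy
        exact h5.mono_right h4.le

/-- `w` is the infimum of the points `y` at which the pattern `As` is completed from some point
of a set of starting points. -/
def CompletesFromSet (As : List Pred) : Pred := fun f w =>
  ∃ S : Set ℝ, (∀ s ∈ S, ¬ Pat As f s w) ∧ ∀ y, w < y → ∃ s ∈ S, Pat As f s y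

/-- `w` is the infimum of the points `y` at which the pattern `As` is completed from some
starting point. -/
def CompletesAt (As : List Pred) : Pred := fun f w =>
  ∃ x, x < w ∧ ¬ Pat As f x w ∧ ∀ y, w < y → Pat As f x y

theorem CompletesAt.completesFromSet {As : List Pred} {f : ℝ → Set ℕ} {w : ℝ}
    (h : CompletesAt As f w) : CompletesFromSet As f w := by
  obtain ⟨x, -, h1, h2⟩ := h
  exact ⟨{x}, by simpa using h1, by simpa using h2⟩

theorem Definable.completesAt {As : List Pred} (h : ∀ A ∈ As, Definable A) :
    Definable (CompletesAt As) :=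
  (((PatBool.pat h).neg.and (.forall_gt_pat h)).chains.definable_exists_left .tt).congr
    fun f w => exists_congr fun x => by tauto

theorem Pat.mono_list {A B : Pred} {f : ℝ → Set ℕ} (h : ∀ r, A f r → B f r) (n : ℕ)
    {x y : ℝ} (hp : Pat (List.replicate n A) f x y) : Pat (List.replicate n B) f x y := by
  induction n generalizing y with
  | zero => exact hp
  | succ n ih =>
    obtain ⟨z, h1, h2, h3⟩ := hp
    exact ⟨z, h1, ih h2, h _ h3⟩

theorem Pat.of_completesFromSet (As : List Pred) {f : ℝ → Set ℕ} : ∀ {x y : ℝ},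
    Pat (List.replicate (2 * As.length) (CompletesFromSet As)) f x y → Pat As f x y := by
  induction As using List.reverseRecOn with
  | nil => exact fun h => h.lt
  | append_singleton As A ih =>
    intro x y h
    have himp : ∀ r, CompletesFromSet (As ++ [A]) f r → CompletesFromSet As f r := by
      rintro r ⟨S, h1, h2⟩
      refine ⟨{r | A f r ∧ ∃ s ∈ S, s < r}, ?_, fun y hy => ?_⟩
      · rintro t ⟨hA, s, hs, hst⟩ hp
        exact h1 s hs (append_singleton.2 ⟨t, hst, hA, hp⟩)
      · obtain ⟨s, hs, hp⟩ := h2 y hy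
        obtain ⟨t, hst, hA, hp⟩ := append_singleton.1 hp
        exact ⟨t, ⟨hA, s, hs, hst⟩, hp⟩
    rw [List.length_append, List.length_singleton, mul_add, mul_one, List.replicate_succ] at h
    obtain ⟨w, hwy, h, S, hS, hS'⟩ := h
    rw [List.replicate_succ', append_singleton] at h
    obtain ⟨v, hxv, -, h⟩ := h
    have hvw := ih (mono_list himp _ h)
    obtain ⟨s, hs, hp⟩ := hS' y hwy
    obtain ⟨r, hsr, hA, hp⟩ := append_singleton.1 hp
    refine append_singleton.2 ⟨r, ?_, hA, hp⟩
    by_contra! hr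
    exact hS s hs (append_singleton.2 ⟨r, hsr, hA, hvw.mono_left (hr.trans hxv.le)⟩)

theorem Definable.pat_unit {As : List Pred} (h : ∀ A ∈ As, Definable A) :
    Definable fun f x => Pat As f x (x + 1) := by
  set W := CompletesAt As with hW
  have hWd : Definable W := .completesAt h
  have hE : ∀ i, Definable fun f x =>
      ¬ ∃ y, x < y ∧ (Pat (List.replicate i W) f x y ∧ ¬ Pat As f x y) ∧ True := fun i =>
    (((PatBool.pat (As := List.replicate i W) fun A hA =>
      List.eq_of_mem_replicate hA ▸ hWd).and
        (PatBool.pat h).neg).chains.definable_exists_right .tt).neg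
  have hC : ∀ i, Definable fun f x => Pat (List.replicate i W) f x (x + 1) := fun i =>
    (hWd.fcount i).congr fun f x => (Pat.replicate_iff W i (lt_add_one x)).symm
  have hex : ∀ n, Definable fun f x => ∃ i < n, (¬ ∃ y, x < y ∧
      (Pat (List.replicate i W) f x y ∧ ¬ Pat As f x y) ∧ True) ∧
        Pat (List.replicate i W) f x (x + 1) := fun n => by
    induction n with
    | zero => exact Definable.ff.congr fun _ _ => by simp
    | succ n ih =>
      refine (ih.or ((hE n).and (hC n))).congr fun f x => ?_
      simp only [Nat.lt_succ_iff_lt_or_eq, or_and_right, exists_or, exists_eq_left]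
  refine (hex (2 * As.length + 1)).congr fun f x => ?_
  constructor
  · rintro ⟨i, -, h1, h2⟩
    by_contra hc
    exact h1 ⟨x + 1, lt_add_one x, ⟨h2, hc⟩, trivial⟩
  intro hT
  have hlast : ¬ ∃ y, x < y ∧
      (Pat (List.replicate (2 * As.length) W) f x y ∧ ¬ Pat As f x y) ∧ True := by
    rintro ⟨y, -, ⟨h1, h2⟩, -⟩
    exact h2 (Pat.of_completesFromSet As
      (h1.mono_list (fun r hr => CompletesAt.completesFromSet hr) _))
  classical
  have hfind : ∃ i, ¬ ∃ y, x < y ∧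
      (Pat (List.replicate i W) f x y ∧ ¬ Pat As f x y) ∧ True := ⟨_, hlast⟩
  refine ⟨Nat.find hfind, Nat.lt_succ_of_le (Nat.find_min' hfind hlast), Nat.find_spec hfind, ?_⟩
  rcases hi : Nat.find hfind with _ | i
  · exact lt_add_one x
  obtain ⟨y, hxy, ⟨h1, h2⟩, -⟩ := not_not.1 (Nat.find_min hfind (m := i) (by omega))
  have lt_of_not : ∀ {u}, ¬ Pat As f x u → u < x + 1 := fun hu => by
    by_contra! hc
    exact hu (hT.mono_right hc)
  have hb : BddAbove {u | ¬ Pat As f x u} := ⟨x + 1, fun u hu => (lt_of_not hu).le⟩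
  have hy : y ≤ sSup {u | ¬ Pat As f x u} := le_csSup hb h2
  have hnot : ¬ Pat As f x (sSup {u | ¬ Pat As f x u}) := fun hc => by
    obtain ⟨u, hu, hp⟩ := hc.left_open
    obtain ⟨u', hu', hlt⟩ := exists_lt_of_lt_csSup ⟨y, h2⟩ hu
    exact hu' (hp.mono_right hlt.le)
  refine ⟨_, lt_of_not hnot, h1.mono_right hy, x, hxy.trans_le hy, hnot, fun u hu => ?_⟩
  by_contra hc
  exact absurd (le_csSup hb hc) (not_le.2 hu)

theorem PatBool.definable_unit {R : Rel} (hR : PatBool R) :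
    Definable fun f x => R f x (x + 1) := by
  induction hR with
  | left hA => exact hA
  | right hA => exact (hA.shift 1).congr fun f x => by simp
  | pat h => exact .pat_unit h
  | neg _ ih => exact ih.neg
  | and _ _ ih1 ih2 => exact ih1.and ih2
  | congr _ h ih => exact ih.congr fun f x => h f x _ (lt_add_one x)

/-- Finite disjunctions of products of chains meeting at an intermediate point. -/
inductive ChainsSplit : ((ℝ → Set ℕ) → ℝ → ℝ → ℝ → Prop) → Prop
  | prod {R S : Rel} : Chains R → Chains S → ChainsSplit fun f x w y => R f x w ∧ S f w y
  | bot : ChainsSplit fun _ _ _ _ => False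
  | or {Θ Λ : (ℝ → Set ℕ) → ℝ → ℝ → ℝ → Prop} : ChainsSplit Θ → ChainsSplit Λ →
      ChainsSplit fun f x w y => Θ f x w y ∨ Λ f x w y
  | congr {Θ Λ : (ℝ → Set ℕ) → ℝ → ℝ → ℝ → Prop} : ChainsSplit Θ →
      (∀ f x w y, x < w → w < y → (Θ f x w y ↔ Λ f x w y)) → ChainsSplit Λ

theorem ChainsSplit.snoc {Θ : (ℝ → Set ℕ) → ℝ → ℝ → ℝ → Prop} {B A : Pred}
    (h : ChainsSplit Θ) (hB : Definable B) (hA : Definable A) :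
    ChainsSplit fun f x w y =>
      ∃ z, w < z ∧ z < y ∧ Θ f x w z ∧ (∀ u, z < u → u < y → B f u) ∧ A f y := by
  induction h with
  | prod hR hS =>
    refine (prod hR (hS.snoc hB hA)).congr fun f x w y _ _ => ?_
    rw [← exists_and_left]
    exact exists_congr fun z => by tauto
  | bot => exact bot.congr fun _ _ _ _ _ _ => by simp
  | or _ _ ih1 ih2 =>
    refine (ih1.or ih2).congr fun f x w y _ _ => ?_
    rw [← exists_or]
    exact exists_congr fun z => by tauto
  | congr _ h ih =>
    exact ih.congr fun f x w y hxw _ => exists_congr fun z =>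
      and_congr_right fun hz => and_congr_right fun _ => and_congr_left' (h f x w z hxw hz)

namespace Chains

variable {R S : Rel}

theorem split (hR : Chains R) : ChainsSplit fun f x _ y => R f x y := by
  induction hR with
  | chain h =>
    induction h with
    | @base L B A hL hB hA =>
      refine (ChainsSplit.prod (((left hL).and (box hB)).and (right hB))
        ((box hB).and (right hA))).congr fun f x w y hxw hwy => ?_
      constructor
      · rintro ⟨⟨⟨h1, h2⟩, h3⟩, h4, h5⟩
        refine ⟨h1, fun u hu hu' => ?_, h5⟩
        rcases lt_trichotomy u w with h | rfl | h
        · exact h2 u hu h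
        · exact h3
        · exact h4 u h hu'
      · rintro ⟨h1, h2, h3⟩
        exact ⟨⟨⟨h1, fun u hu hu' => h2 u hu (hu'.trans hwy)⟩, h2 w hxw hwy⟩,
          fun u hu hu' => h2 u (hxw.trans hu) hu', h3⟩
    | @snoc C B A hC hB hA ih =>
      refine (((ChainsSplit.prod ((chain hC).snoc hB hB) ((box hB).and (right hA))).or
        (.prod (chain hC) ((box hB).and (right hA)))).or (ih.snoc hB hA)).congr
          fun f x w y hxw hwy => ?_
      constructor
      · rintro ((⟨⟨z, h1, h2, h3, h4, h5⟩, h6, h7⟩ | ⟨h3, h4, h5⟩) | ⟨z, h1, h2, h3⟩)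
        · refine ⟨z, h1, h2.trans hwy, h3, fun u hu hu' => ?_, h7⟩
          rcases lt_trichotomy u w with h | rfl | h
          · exact h4 u hu h
          · exact h5
          · exact h6 u h hu'
        · exact ⟨w, hxw, hwy, h3, h4, h5⟩
        · exact ⟨z, hxw.trans h1, h2, h3⟩
      · rintro ⟨z, h1, h2, h3, h4, h5⟩
        rcases lt_trichotomy z w with h | rfl | h
        · exact .inl (.inl ⟨⟨z, h1, h, h3, fun u hu hu' => h4 u hu (hu'.trans hwy), h4 w h hwy⟩,
            fun u hu hu' => h4 u (h.trans hu) hu', h5⟩)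
        · exact .inl (.inr ⟨h3, h4, h5⟩)
        · exact .inr ⟨z, h, h2, h3, h4, h5⟩
  | bot => exact .bot
  | or _ _ ih1 ih2 => exact ih1.or ih2
  | congr _ h ih => exact ih.congr fun f x w y hxw hwy => h f x y (hxw.trans hwy)

theorem shift (hR : Chains R) (c : ℤ) : Chains fun f x y => R f (x + c) (y + c) := by
  induction hR with
  | chain h =>
    induction h with
    | base hL hB hA =>
      refine (chain (.base (hL.shift c) (hB.shift c) (hA.shift c))).congr fun f x y _ => ?_
      refine and_congr_right' (and_congr_left' ⟨fun h u h1 h2 => ?_, fun h u h1 h2 => ?_⟩)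
      · simpa using h (u - c) (by linarith) (by linarith)
      · exact h _ (by linarith) (by linarith)
    | snoc _ hB hA ih =>
      refine (ih.snoc (hB.shift c) (hA.shift c)).congr fun f x y _ => ?_
      constructor
      · rintro ⟨z, h1, h2, h3, h4, h5⟩
        refine ⟨z + c, by linarith, by linarith, h3, fun u h6 h7 => ?_, h5⟩
        simpa using h4 (u - c) (by linarith) (by linarith)
      · rintro ⟨z, h1, h2, h3, h4, h5⟩
        refine ⟨z - c, by linarith, by linarith, by simpa using h3, fun u h6 h7 => ?_, h5⟩
        exact h4 _ (by linarith) (by linarith)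
  | bot => exact bot
  | or _ _ ih1 ih2 => exact ih1.or ih2
  | congr _ h ih => exact ih.congr fun f x y hxy => h f _ _ (by linarith)

theorem concat (hR : Chains R) (hS : Chains S) :
    Chains fun f x y => ∃ z, x < z ∧ z < y ∧ R f x z ∧ S f z y := by
  induction hS with
  | chain h =>
    induction h with
    | base hL hB hA =>
      exact ((hR.and_right hL).snoc hB hA).congr fun f x y _ => exists_congr fun z => by tauto
    | snoc _ hB hA ih =>
      refine (ih.snoc hB hA).congr fun f x y _ => ?_
      constructor
      · rintro ⟨w, h1, h2, ⟨z, h3, h4, h5, h6⟩, h7, h8⟩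
        exact ⟨z, h3, h4.trans h2, h5, w, h4, h2, h6, h7, h8⟩
      · rintro ⟨z, h3, _, h5, w, h4, h2, h6, h7, h8⟩
        exact ⟨w, h3.trans h4, h2, ⟨z, h3, h4, h5, h6⟩, h7, h8⟩
  | bot => exact bot.congr fun _ _ _ _ => by simp
  | or _ _ ih1 ih2 =>
    refine (ih1.or ih2).congr fun f x y _ => ?_
    rw [← exists_or]
    exact exists_congr fun z => by tauto
  | congr _ h ih =>
    exact ih.congr fun f x y _ => exists_congr fun z => and_congr_right fun _ =>
      and_congr_right fun hz => and_congr_right' (h f z y hz)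

theorem definable_add_nat (hR : Chains R) (n : ℕ) :
    Definable fun f x => R f x (x + (n + 1 : ℕ)) := by
  induction n generalizing R with
  | zero => exact hR.patBool.definable_unit.congr fun f x => by simp
  | succ n ih =>
    have key : ∀ {Θ}, ChainsSplit Θ →
        Definable fun f x => Θ f x (x + (n + 1 : ℕ)) (x + (n + 1 + 1 : ℕ)) := fun hΘ => by
      induction hΘ with
      | prod hR hS =>
        refine ((ih hR).and (hS.patBool.definable_unit.shift (n + 1 : ℕ))).congr fun f x => ?_
        push_cast
        simp only [add_assoc]
      | bot => exact .ff
      | or _ _ ih1 ih2 => exact ih1.or ih2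
      | congr _ h ih =>
        refine ih.congr fun f x => h f x _ _ ?_ ?_
        · simp only [lt_add_iff_pos_right]
          positivity
        · push_cast
          linarith
    exact key hR.split

theorem definable_add_int (hR : Chains R) {c : ℤ} (hc : c < 0) :
    Definable fun f x => R f (x + c) x := by
  obtain ⟨n, rfl⟩ : ∃ n : ℕ, c = -((n + 1 : ℕ) : ℤ) :=
    ⟨(-c).toNat - 1, by omega⟩
  refine ((hR.definable_add_nat n).shift (-((n + 1 : ℕ) : ℤ))).congr fun f x => ?_
  push_cast
  rw [show x + (-((n : ℝ) + 1)) + (n + 1) = x by ring]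

end Chains

/-- The value of the term `v j + c` with an integer shift. -/
def intTermVal (v : ℕ → ℝ) (t : ℕ × ℤ) : ℝ := v t.1 + t.2

/-- Boolean combinations of properties of single variables and of chains between integer shifts
of two variables. -/
inductive Separated : ((ℝ → Set ℕ) → (ℕ → ℝ) → Prop) → Prop
  | unary {A : Pred} (i : ℕ) : Definable A → Separated fun f v => A f (v i)
  | rel {R : Rel} (i j : ℕ) (c : ℤ) : Chains R →
      Separated fun f v => v i + c < v j ∧ R f (v i + c) (v j)
  | neg {Φ : (ℝ → Set ℕ) → (ℕ → ℝ) → Prop} : Separated Φ → Separated fun f v => ¬ Φ f v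
  | and {Φ Ψ : (ℝ → Set ℕ) → (ℕ → ℝ) → Prop} : Separated Φ → Separated Ψ →
      Separated fun f v => Φ f v ∧ Ψ f v

namespace Separated

variable {Φ Ψ : (ℝ → Set ℕ) → (ℕ → ℝ) → Prop}

theorem congr (hΦ : Separated Φ) (h : ∀ f v, Φ f v ↔ Ψ f v) : Separated Ψ := by
  obtain rfl : Φ = Ψ := funext fun f => funext fun v => propext (h f v)
  exact hΦ

theorem or (hΦ : Separated Φ) (hΨ : Separated Ψ) : Separated fun f v => Φ f v ∨ Ψ f v :=
  (hΦ.neg.and hΨ.neg).neg.congr fun _ _ => by tauto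

theorem tt : Separated fun _ _ => True := unary 0 .tt

theorem ff : Separated fun _ _ => False := unary 0 .ff

theorem exists_mem {ι : Type} {Θ : ι → (ℝ → Set ℕ) → (ℕ → ℝ) → Prop} (l : List ι)
    (h : ∀ i ∈ l, Separated (Θ i)) : Separated fun f v => ∃ i ∈ l, Θ i f v := by
  induction l with
  | nil => exact ff.congr fun _ _ => by simp
  | cons i l ih =>
    exact ((h i (by simp)).or (ih fun j hj => h j (by simp [hj]))).congr fun _ _ => by simp

theorem forall_mem {ι : Type} {Θ : ι → (ℝ → Set ℕ) → (ℕ → ℝ) → Prop} (l : List ι)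
    (h : ∀ i ∈ l, Separated (Θ i)) : Separated fun f v => ∀ i ∈ l, Θ i f v :=
  (exists_mem l fun i hi => (h i hi).neg).neg.congr fun _ _ => by simp

theorem term {A : Pred} (hA : Definable A) (t : ℕ × ℤ) :
    Separated fun f v => A f (intTermVal v t) :=
  unary t.1 (hA.shift t.2)

theorem rel_term {R : Rel} (hR : Chains R) (s t : ℕ × ℤ) : Separated fun f v =>
    intTermVal v s < intTermVal v t ∧ R f (intTermVal v s) (intTermVal v t) := by
  refine (rel s.1 t.1 (s.2 - t.2) (hR.shift t.2)).congr fun f v => ?_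
  simp only [intTermVal, Int.cast_sub]
  rw [show v s.1 + ((s.2 : ℝ) - t.2) + t.2 = v s.1 + s.2 by ring]
  exact and_congr_left' ⟨fun h => by linarith, fun h => by linarith⟩

theorem lt (s t : ℕ × ℤ) : Separated fun _ v => intTermVal v s < intTermVal v t :=
  (rel_term .tt s t).congr fun _ _ => by simp

theorem le (s t : ℕ × ℤ) : Separated fun _ v => intTermVal v s ≤ intTermVal v t :=
  (lt t s).neg.congr fun _ _ => not_lt

theorem eq (s t : ℕ × ℤ) : Separated fun _ v => intTermVal v s = intTermVal v t :=
  ((le s t).and (le t s)).congr fun _ _ => le_antisymm_iff.symm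

end Separated

/-- Boolean combinations of parameters, properties of a point `r`, and chains between `r` and
the terms in a list. -/
inductive Localized (T : List (ℕ × ℤ)) : ((ℝ → Set ℕ) → (ℕ → ℝ) → ℝ → Prop) → Prop
  | param {Φ : (ℝ → Set ℕ) → (ℕ → ℝ) → Prop} : Separated Φ → Localized T fun f v _ => Φ f v
  | unary {A : Pred} : Definable A → Localized T fun f _ r => A f r
  | left {R : Rel} {t : ℕ × ℤ} : t ∈ T → Chains R →
      Localized T fun f v r => intTermVal v t < r ∧ R f (intTermVal v t) r
  | right {R : Rel} {t : ℕ × ℤ} : t ∈ T → Chains R →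
      Localized T fun f v r => r < intTermVal v t ∧ R f r (intTermVal v t)
  | neg {Φ : (ℝ → Set ℕ) → (ℕ → ℝ) → ℝ → Prop} : Localized T Φ →
      Localized T fun f v r => ¬ Φ f v r
  | and {Φ Ψ : (ℝ → Set ℕ) → (ℕ → ℝ) → ℝ → Prop} : Localized T Φ → Localized T Ψ →
      Localized T fun f v r => Φ f v r ∧ Ψ f v r

namespace Localized

variable {T T' : List (ℕ × ℤ)} {Φ Ψ : (ℝ → Set ℕ) → (ℕ → ℝ) → ℝ → Prop}

theorem congr (hΦ : Localized T Φ) (h : ∀ f v r, Φ f v r ↔ Ψ f v r) : Localized T Ψ := by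
  obtain rfl : Φ = Ψ := funext fun f => funext fun v => funext fun r => propext (h f v r)
  exact hΦ

theorem mono (hΦ : Localized T Φ) (h : T ⊆ T') : Localized T' Φ := by
  induction hΦ with
  | param hΦ => exact .param hΦ
  | unary hA => exact .unary hA
  | left ht hR => exact .left (h ht) hR
  | right ht hR => exact .right (h ht) hR
  | neg _ ih => exact ih.neg
  | and _ _ ih1 ih2 => exact ih1.and ih2

theorem separated_term (hΦ : Localized T Φ) (t : ℕ × ℤ) :
    Separated fun f v => Φ f v (intTermVal v t) := by
  induction hΦ with
  | param hΦ => exact hΦ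
  | unary hA => exact .term hA t
  | left _ hR => exact .rel_term hR _ _
  | right _ hR => exact .rel_term hR _ _
  | neg _ ih => exact ih.neg
  | and _ _ ih1 ih2 => exact ih1.and ih2

end Localized

theorem Separated.localized {Φ : (ℝ → Set ℕ) → (ℕ → ℝ) → Prop} (hΦ : Separated Φ) (x : ℕ) :
    ∃ T, Localized T fun f v r => Φ f (Function.update v x r) := by
  induction hΦ with
  | @unary A i hA =>
    refine ⟨[], ?_⟩
    by_cases h : i = x
    · subst h
      exact (Localized.unary hA).congr fun f v r => by simp
    · exact (Localized.param (.unary i hA)).congr fun f v r => by simp [h]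
  | @rel R i j c hR =>
    by_cases hi : i = x <;> by_cases hj : j = x
    · subst hi hj
      refine ⟨[], ?_⟩
      by_cases hc : c < 0
      · exact (Localized.unary (hR.definable_add_int hc)).congr fun f v r => by simp [hc]
      · exact (Localized.param .ff).congr fun f v r => by simp [hc]
    · subst hi
      refine ⟨[(j, -c)], (Localized.right (List.mem_singleton_self _) (hR.shift c)).congr
        fun f v r => ?_⟩
      simp only [intTermVal, Int.cast_neg, Function.update_self, Function.update_of_ne hj,
        neg_add_cancel_right]
      exact and_congr_left' ⟨fun h => by linarith, fun h => by linarith⟩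
    · subst hj
      exact ⟨[(i, c)], (Localized.left (List.mem_singleton_self _) hR).congr fun f v r => by
        simp [intTermVal, hi]⟩
    · exact ⟨[], (Localized.param (.rel i j c hR)).congr fun f v r => by simp [hi, hj]⟩
  | neg _ ih =>
    obtain ⟨T, h⟩ := ih
    exact ⟨T, h.neg⟩
  | and _ _ ih1 ih2 =>
    obtain ⟨T, h⟩ := ih1
    obtain ⟨T', h'⟩ := ih2
    exact ⟨T ++ T', (h.mono (List.subset_append_left _ _)).and
      (h'.mono (List.subset_append_right _ _))⟩

/-- Chains from an optional left endpoint; without endpoint, properties of the point itself. -/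
def LeftFactor : Option (ℕ × ℤ) → ((ℝ → Set ℕ) → (ℕ → ℝ) → ℝ → Prop) → Prop
  | none, L => ∃ A, Definable A ∧ L = fun f _ r => A f r
  | some s, L => ∃ R, Chains R ∧ L = fun f v r => R f (intTermVal v s) r

/-- Chains to an optional right endpoint; without endpoint, properties of the point itself. -/
def RightFactor : Option (ℕ × ℤ) → ((ℝ → Set ℕ) → (ℕ → ℝ) → ℝ → Prop) → Prop
  | none, L => ∃ A, Definable A ∧ L = fun f _ r => A f r
  | some t, L => ∃ R, Chains R ∧ L = fun f v r => R f r (intTermVal v t)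

section Factors

variable {s : Option (ℕ × ℤ)} {L M : (ℝ → Set ℕ) → (ℕ → ℝ) → ℝ → Prop}

theorem LeftFactor.of_definable {A : Pred} (hA : Definable A) :
    LeftFactor s fun f _ r => A f r := by
  cases s with
  | none => exact ⟨A, hA, rfl⟩
  | some s => exact ⟨_, .right hA, rfl⟩

theorem LeftFactor.of_chains {R : Rel} (hR : Chains R) (s : ℕ × ℤ) :
    LeftFactor (some s) fun f v r => R f (intTermVal v s) r :=
  ⟨R, hR, rfl⟩

theorem LeftFactor.neg (hL : LeftFactor s L) : LeftFactor s fun f v r => ¬ L f v r := by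
  cases s with
  | none =>
    obtain ⟨A, hA, rfl⟩ := hL
    exact ⟨_, hA.neg, rfl⟩
  | some s =>
    obtain ⟨A, hA, rfl⟩ := hL
    exact ⟨_, hA.neg, rfl⟩

theorem LeftFactor.and (hL : LeftFactor s L) (hM : LeftFactor s M) :
    LeftFactor s fun f v r => L f v r ∧ M f v r := by
  cases s with
  | none =>
    obtain ⟨A, hA, rfl⟩ := hL
    obtain ⟨B, hB, rfl⟩ := hM
    exact ⟨_, hA.and hB, rfl⟩
  | some s =>
    obtain ⟨A, hA, rfl⟩ := hL
    obtain ⟨B, hB, rfl⟩ := hM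
    exact ⟨_, hA.and hB, rfl⟩

theorem RightFactor.of_definable {A : Pred} (hA : Definable A) :
    RightFactor s fun f _ r => A f r := by
  cases s with
  | none => exact ⟨A, hA, rfl⟩
  | some s => exact ⟨_, .left hA, rfl⟩

theorem RightFactor.of_chains {R : Rel} (hR : Chains R) (t : ℕ × ℤ) :
    RightFactor (some t) fun f v r => R f r (intTermVal v t) :=
  ⟨R, hR, rfl⟩

theorem RightFactor.neg (hL : RightFactor s L) : RightFactor s fun f v r => ¬ L f v r := by
  cases s with
  | none =>
    obtain ⟨A, hA, rfl⟩ := hL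
    exact ⟨_, hA.neg, rfl⟩
  | some s =>
    obtain ⟨A, hA, rfl⟩ := hL
    exact ⟨_, hA.neg, rfl⟩

theorem RightFactor.and (hL : RightFactor s L) (hM : RightFactor s M) :
    RightFactor s fun f v r => L f v r ∧ M f v r := by
  cases s with
  | none =>
    obtain ⟨A, hA, rfl⟩ := hL
    obtain ⟨B, hB, rfl⟩ := hM
    exact ⟨_, hA.and hB, rfl⟩
  | some s =>
    obtain ⟨A, hA, rfl⟩ := hL
    obtain ⟨B, hB, rfl⟩ := hM
    exact ⟨_, hA.and hB, rfl⟩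

end Factors

/-- No term of the list has its value strictly between the optional endpoints. -/
def IsGap (s t : Option (ℕ × ℤ)) (T : List (ℕ × ℤ)) (v : ℕ → ℝ) : Prop :=
  ∀ u ∈ T, (∃ s' ∈ s, intTermVal v u ≤ intTermVal v s') ∨
    ∃ t' ∈ t, intTermVal v t' ≤ intTermVal v u

/-- The point `r` lies strictly between the optional endpoints. -/
def IsBetween (s t : Option (ℕ × ℤ)) (v : ℕ → ℝ) (r : ℝ) : Prop :=
  (∀ s' ∈ s, intTermVal v s' < r) ∧ ∀ t' ∈ t, r < intTermVal v t'

theorem Separated.isGap (s t : Option (ℕ × ℤ)) (T : List (ℕ × ℤ)) :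
    Separated fun _ v => IsGap s t T v := by
  refine forall_mem T fun u _ => ?_
  rcases s with _ | s <;> rcases t with _ | t
  · exact ff.congr fun _ _ => by simp
  · exact (le t u).congr fun _ _ => by simp
  · exact (le u s).congr fun _ _ => by simp
  · exact ((le u s).or (le t u)).congr fun _ _ => by simp

/-- Finite disjunctions of products of a parameter, a left factor and a right factor, up to
agreement at the points in the gap between the endpoints. -/
inductive SumProd (s t : Option (ℕ × ℤ)) (T : List (ℕ × ℤ)) :
    ((ℝ → Set ℕ) → (ℕ → ℝ) → ℝ → Prop) → Prop
  | prod {Φ : (ℝ → Set ℕ) → (ℕ → ℝ) → Prop} {L R : (ℝ → Set ℕ) → (ℕ → ℝ) → ℝ → Prop} :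
      Separated Φ → LeftFactor s L → RightFactor t R →
      SumProd s t T fun f v r => Φ f v ∧ L f v r ∧ R f v r
  | bot : SumProd s t T fun _ _ _ => False
  | or {Φ Ψ : (ℝ → Set ℕ) → (ℕ → ℝ) → ℝ → Prop} : SumProd s t T Φ → SumProd s t T Ψ →
      SumProd s t T fun f v r => Φ f v r ∨ Ψ f v r
  | congr {Φ Ψ : (ℝ → Set ℕ) → (ℕ → ℝ) → ℝ → Prop} : SumProd s t T Φ →
      (∀ f v r, IsGap s t T v → IsBetween s t v r → (Φ f v r ↔ Ψ f v r)) → SumProd s t T Ψ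

namespace SumProd

variable {s t : Option (ℕ × ℤ)} {T : List (ℕ × ℤ)}
  {Φ Ψ : (ℝ → Set ℕ) → (ℕ → ℝ) → ℝ → Prop}

theorem param {X : (ℝ → Set ℕ) → (ℕ → ℝ) → Prop} (hX : Separated X) :
    SumProd s t T fun f v _ => X f v :=
  (prod hX (.of_definable .tt) (.of_definable .tt)).congr fun _ _ _ _ _ => by simp

theorem leftFactor (hΦ : LeftFactor s Φ) : SumProd s t T Φ :=
  (prod .tt hΦ (.of_definable .tt)).congr fun _ _ _ _ _ => by simp

theorem rightFactor (hΦ : RightFactor t Φ) : SumProd s t T Φ :=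
  (prod .tt (.of_definable .tt) hΦ).congr fun _ _ _ _ _ => by simp

theorem and (hΦ : SumProd s t T Φ) (hΨ : SumProd s t T Ψ) :
    SumProd s t T fun f v r => Φ f v r ∧ Ψ f v r := by
  induction hΦ with
  | prod h1 h2 h3 =>
    induction hΨ with
    | prod h1' h2' h3' =>
      exact (prod (h1.and h1') (h2.and h2') (h3.and h3')).congr fun _ _ _ _ _ => by tauto
    | bot => exact bot.congr fun _ _ _ _ _ => by simp
    | or _ _ ih1 ih2 => exact (ih1.or ih2).congr fun _ _ _ _ _ => by tauto
    | congr _ h ih => exact ih.congr fun f v r h1 h2 => and_congr_right' (h f v r h1 h2)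
  | bot => exact bot.congr fun _ _ _ _ _ => by simp
  | or _ _ ih1 ih2 => exact (ih1.or ih2).congr fun _ _ _ _ _ => by tauto
  | congr _ h ih => exact ih.congr fun f v r h1 h2 => and_congr_left' (h f v r h1 h2)

theorem neg (hΦ : SumProd s t T Φ) : SumProd s t T fun f v r => ¬ Φ f v r := by
  induction hΦ with
  | prod h1 h2 h3 =>
    exact ((param h1.neg).or ((leftFactor h2.neg).or (rightFactor h3.neg))).congr
      fun _ _ _ _ _ => by tauto
  | bot => exact (param .tt).congr fun _ _ _ _ _ => by simp
  | or _ _ ih1 ih2 => exact (ih1.and ih2).congr fun _ _ _ _ _ => by tauto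
  | congr _ h ih => exact ih.congr fun f v r h1 h2 => not_congr (h f v r h1 h2)

theorem left_of_split {Θ : (ℝ → Set ℕ) → ℝ → ℝ → ℝ → Prop} (hΘ : ChainsSplit Θ)
    (u s : ℕ × ℤ) : SumProd (some s) t T fun f v r => intTermVal v u < intTermVal v s ∧
      Θ f (intTermVal v u) (intTermVal v s) r := by
  induction hΘ with
  | prod hR hS =>
    exact ((param (.rel_term hR u s)).and (leftFactor (.of_chains hS s))).congr
      fun _ _ _ _ _ => by tauto
  | bot => exact bot.congr fun _ _ _ _ _ => by simp
  | or _ _ ih1 ih2 => exact (ih1.or ih2).congr fun _ _ _ _ _ => by tauto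
  | congr _ h ih =>
    exact ih.congr fun f v r _ hr => and_congr_right fun hu => h _ _ _ _ hu (hr.1 s rfl)

theorem right_of_split {Θ : (ℝ → Set ℕ) → ℝ → ℝ → ℝ → Prop} (hΘ : ChainsSplit Θ)
    (u t : ℕ × ℤ) : SumProd s (some t) T fun f v r => intTermVal v t < intTermVal v u ∧
      Θ f r (intTermVal v t) (intTermVal v u) := by
  induction hΘ with
  | prod hR hS =>
    exact ((param (.rel_term hS t u)).and (rightFactor (.of_chains hR t))).congr
      fun _ _ _ _ _ => by tauto
  | bot => exact bot.congr fun _ _ _ _ _ => by simp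
  | or _ _ ih1 ih2 => exact (ih1.or ih2).congr fun _ _ _ _ _ => by tauto
  | congr _ h ih =>
    exact ih.congr fun f v r _ hr => and_congr_right fun hu => h _ _ _ _ (hr.2 t rfl) hu

theorem left {R : Rel} (hR : Chains R) {u : ℕ × ℤ} (hu : u ∈ T) :
    SumProd s t T fun f v r => intTermVal v u < r ∧ R f (intTermVal v u) r := by
  cases s with
  | none =>
    refine bot.congr fun f v r hg hr => ?_
    simp only [false_iff, not_and]
    intro hur
    obtain ⟨s, hs, -⟩ | ⟨t', ht', h⟩ := hg u hu
    · cases hs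
    · exact absurd (hur.trans (hr.2 t' ht')) (not_lt.2 h)
  | some s =>
    refine ((left_of_split hR.split u s).or ((param (.eq u s)).and
      (leftFactor (.of_chains hR s)))).congr fun f v r hg hr => ?_
    have hsr := hr.1 s rfl
    constructor
    · rintro (⟨h1, h2⟩ | ⟨h1, h2⟩)
      · exact ⟨h1.trans hsr, h2⟩
      · rw [h1]
        exact ⟨hsr, h2⟩
    · rintro ⟨h1, h2⟩
      obtain ⟨s', hs', h⟩ | ⟨t', ht', h⟩ := hg u hu
      · obtain rfl := Option.some.inj hs'
        rcases h.lt_or_eq with h | h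
        · exact .inl ⟨h, h2⟩
        · exact .inr ⟨h, h ▸ h2⟩
      · exact absurd (h1.trans (hr.2 t' ht')) (not_lt.2 h)

theorem right {R : Rel} (hR : Chains R) {u : ℕ × ℤ} (hu : u ∈ T) :
    SumProd s t T fun f v r => r < intTermVal v u ∧ R f r (intTermVal v u) := by
  cases t with
  | none =>
    refine bot.congr fun f v r hg hr => ?_
    simp only [false_iff, not_and]
    intro hur
    obtain ⟨s', hs', h⟩ | ⟨t', ht', -⟩ := hg u hu
    · exact absurd ((hr.1 s' hs').trans hur) (not_lt.2 h)
    · cases ht'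
  | some t =>
    refine ((right_of_split hR.split u t).or ((param (.eq t u)).and
      (rightFactor (.of_chains hR t)))).congr fun f v r hg hr => ?_
    have hrt := hr.2 t rfl
    constructor
    · rintro (⟨h1, h2⟩ | ⟨h1, h2⟩)
      · exact ⟨hrt.trans h1, h2⟩
      · rw [← h1]
        exact ⟨hrt, h2⟩
    · rintro ⟨h1, h2⟩
      obtain ⟨s', hs', h⟩ | ⟨t', ht', h⟩ := hg u hu
      · exact absurd ((hr.1 s' hs').trans h1) (not_lt.2 h)
      · obtain rfl := Option.some.inj ht'
        rcases h.lt_or_eq with h | h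
        · exact .inl ⟨h, h2⟩
        · exact .inr ⟨h, h.symm ▸ h2⟩

theorem separated_exists (hΦ : SumProd s t T Φ) :
    Separated fun f v => IsGap s t T v ∧ ∃ r, IsBetween s t v r ∧ Φ f v r := by
  induction hΦ with
  | @prod X L R hX hL hR =>
    suffices h : Separated fun f v => ∃ r, IsBetween s t v r ∧ L f v r ∧ R f v r by
      refine ((Separated.isGap s t T).and (hX.and h)).congr fun f v => and_congr_right' ?_
      rw [← exists_and_left]
      exact exists_congr fun r => by tauto
    cases s with
    | none =>
      obtain ⟨A, hA, rfl⟩ := hL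
      cases t with
      | none =>
        obtain ⟨B, hB, rfl⟩ := hR
        refine (Separated.unary 0 ((hA.and hB).or ((Definable.tt.untl (hA.and hB)).or
          (Definable.tt.sinc (hA.and hB))))).congr fun f v => ?_
        simp only [IsBetween, Option.not_mem_none, false_implies, implies_true, true_and]
        constructor
        · rintro (h | ⟨r, -, h⟩ | ⟨r, -, h⟩) <;> exact ⟨_, h⟩
        · rintro ⟨r, h⟩
          rcases lt_trichotomy (v 0) r with hr | rfl | hr
          · exact .inr (.inl ⟨r, hr, h⟩)
          · exact .inl h
          · exact .inr (.inr ⟨r, hr, h⟩)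
      | some t =>
        obtain ⟨B, hB, rfl⟩ := hR
        refine (Separated.term (hB.definable_exists_left hA) t).congr fun f v => ?_
        simp [IsBetween]
    | some s =>
      obtain ⟨A, hA, rfl⟩ := hL
      cases t with
      | none =>
        obtain ⟨B, hB, rfl⟩ := hR
        refine (Separated.term (hA.definable_exists_right hB) s).congr fun f v => ?_
        simp [IsBetween]
      | some t =>
        obtain ⟨B, hB, rfl⟩ := hR
        refine (Separated.rel_term (hA.concat hB) s t).congr fun f v => ?_
        simp only [IsBetween, Option.mem_some_iff, forall_eq', and_assoc]
        exact ⟨fun h => h.2, fun h => ⟨h.choose_spec.1.trans h.choose_spec.2.1, h⟩⟩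
  | bot => exact Separated.ff.congr fun _ _ => by simp
  | or _ _ ih1 ih2 =>
    refine (ih1.or ih2).congr fun f v => ?_
    rw [← and_or_left, ← exists_or]
    exact and_congr_right' (exists_congr fun r => by tauto)
  | congr _ h ih =>
    exact ih.congr fun f v => and_congr_right fun hg => exists_congr fun r =>
      and_congr_right fun hr => h f v r hg hr

end SumProd

theorem Localized.sumProd {s t : Option (ℕ × ℤ)} {T : List (ℕ × ℤ)}
    {Φ : (ℝ → Set ℕ) → (ℕ → ℝ) → ℝ → Prop} (hΦ : Localized T Φ) : SumProd s t T Φ := by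
  induction hΦ with
  | param hΦ => exact .param hΦ
  | unary hA => exact .leftFactor (.of_definable hA)
  | left ht hR => exact .left hR ht
  | right ht hR => exact .right hR ht
  | neg _ ih => exact ih.neg
  | and _ _ ih1 ih2 => exact ih1.and ih2

theorem exists_isGap_isBetween {T : List (ℕ × ℤ)} {v : ℕ → ℝ} {r : ℝ}
    (hr : ∀ t ∈ T, r ≠ intTermVal v t) : ∃ s ∈ none :: T.map some, ∃ t ∈ none :: T.map some,
      IsGap s t T v ∧ IsBetween s t v r := by
  induction T with
  | nil => exact ⟨none, by simp, none, by simp, by simp [IsGap], by simp [IsBetween]⟩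
  | cons u T ih =>
    obtain ⟨s, hs, t, ht, hg, hb⟩ := ih fun t ht => hr t (by simp [ht])
    have hmem : ∀ o ∈ none :: T.map some, o ∈ none :: (u :: T).map some := fun o ho => by
      simp only [List.map_cons, List.mem_cons] at ho ⊢
      tauto
    rcases (hr u (by simp)).lt_or_gt with h | h
    · by_cases hc : ∃ t' ∈ t, intTermVal v t' ≤ intTermVal v u
      · refine ⟨s, hmem s hs, t, hmem t ht, fun w hw => ?_, hb⟩
        rcases List.mem_cons.1 hw with rfl | hw
        · exact .inr hc
        · exact hg w hw
      · push Not at hc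
        refine ⟨s, hmem s hs, some u, by simp, fun w hw => ?_, hb.1, by simpa using h⟩
        rcases List.mem_cons.1 hw with rfl | hw
        · exact .inr ⟨_, rfl, le_rfl⟩
        · refine (hg w hw).imp_right ?_
          rintro ⟨t', ht', h'⟩
          exact ⟨u, rfl, (hc t' ht').le.trans h'⟩
    · by_cases hc : ∃ s' ∈ s, intTermVal v u ≤ intTermVal v s'
      · refine ⟨s, hmem s hs, t, hmem t ht, fun w hw => ?_, hb⟩
        rcases List.mem_cons.1 hw with rfl | hw
        · exact .inl hc
        · exact hg w hw
      · push Not at hc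
        refine ⟨some u, by simp, t, hmem t ht, fun w hw => ?_, by simpa using h, hb.2⟩
        rcases List.mem_cons.1 hw with rfl | hw
        · exact .inl ⟨_, rfl, le_rfl⟩
        · refine (hg w hw).imp_left ?_
          rintro ⟨s', hs', h'⟩
          exact ⟨u, rfl, h'.trans (hc s' hs').le⟩

theorem Localized.separated_exists {T : List (ℕ × ℤ)}
    {Φ : (ℝ → Set ℕ) → (ℕ → ℝ) → ℝ → Prop} (hΦ : Localized T Φ) :
    Separated fun f v => ∃ r, Φ f v r := by
  refine ((Separated.exists_mem T fun t _ => hΦ.separated_term t).or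
    (Separated.exists_mem (none :: T.map some) fun s _ =>
      Separated.exists_mem (none :: T.map some) fun t _ =>
        (hΦ.sumProd (s := s) (t := t)).separated_exists)).congr fun f v => ?_
  constructor
  · rintro (⟨t, -, h⟩ | ⟨s, -, t, -, -, r, -, h⟩)
    · exact ⟨_, h⟩
    · exact ⟨r, h⟩
  · rintro ⟨r, h⟩
    by_cases hr : ∃ t ∈ T, r = intTermVal v t
    · obtain ⟨t, ht, rfl⟩ := hr
      exact .inl ⟨t, ht, h⟩
    · push Not at hr
      obtain ⟨s, hs, t, ht, hg, hb⟩ := exists_isGap_isBetween hr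
      exact .inr ⟨s, hs, t, ht, hg, r, hb, h⟩

theorem exists_intCast_eq_of_mem_intZ {c : ℝ} (hc : c ∈ intZ) : ∃ n : ℤ, (n : ℝ) = c := by
  obtain ⟨n, rfl⟩ := AddSubgroup.mem_zmultiples_iff.1 hc
  exact ⟨n, by simp⟩

theorem Separated.fo (φ : FO intZ ℕ) : Separated fun f v => φ.sat f v := by
  induction φ with
  | tt => exact .tt
  | atom p t =>
    obtain ⟨n, hn⟩ := exists_intCast_eq_of_mem_intZ t.2.2
    exact (term (.atom p) (t.1, n)).congr fun f v => by
      simp only [intTermVal, hn]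
      rfl
  | lt s t =>
    obtain ⟨m, hm⟩ := exists_intCast_eq_of_mem_intZ s.2.2
    obtain ⟨n, hn⟩ := exists_intCast_eq_of_mem_intZ t.2.2
    exact (lt (s.1, m) (t.1, n)).congr fun f v => by
      simp only [intTermVal, hm, hn]
      rfl
  | conj _ _ ih1 ih2 => exact ih1.and ih2
  | neg _ ih => exact ih.neg
  | ex x _ ih =>
    obtain ⟨T, h⟩ := ih.localized x
    exact h.separated_exists

theorem Separated.definable {Φ : (ℝ → Set ℕ) → (ℕ → ℝ) → Prop} (hΦ : Separated Φ) :
    Definable fun f r => Φ f fun _ => r := by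
  induction hΦ with
  | unary _ hA => exact hA
  | rel _ _ c hR =>
    by_cases hc : c < 0
    · exact (hR.definable_add_int hc).congr fun f r => by simp [hc]
    · exact Definable.ff.congr fun f r => by simp [hc]
  | neg _ ih => exact ih.neg
  | and _ _ ih1 ih2 => exact ih1.and ih2

/-- A property of valuations is expressed by some `FO_ℤ` formula with free variables in `S`. -/
def FODefinable (S : Set ℕ) (Φ : (ℝ → Set ℕ) → (ℕ → ℝ) → Prop) : Prop :=
  ∃ φ : FO intZ ℕ, φ.free ⊆ S ∧ ∀ f v, φ.sat f v ↔ Φ f v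

namespace FODefinable

variable {S T : Set ℕ} {Φ Ψ : (ℝ → Set ℕ) → (ℕ → ℝ) → Prop}

theorem congr (hΦ : FODefinable S Φ) (h : ∀ f v, Φ f v ↔ Ψ f v) : FODefinable S Ψ := by
  obtain ⟨φ, hS, hφ⟩ := hΦ
  exact ⟨φ, hS, fun f v => (hφ f v).trans (h f v)⟩

theorem mono (hΦ : FODefinable S Φ) (h : S ⊆ T) : FODefinable T Φ := by
  obtain ⟨φ, hS, hφ⟩ := hΦ
  exact ⟨φ, hS.trans h, hφ⟩

theorem tt : FODefinable S fun _ _ => True := ⟨.tt, by simp [FO.free], fun _ _ => Iff.rfl⟩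

theorem atom (p x : ℕ) : FODefinable {x} fun f v => p ∈ f (v x) :=
  ⟨.atom p (x, 0), by simp [FO.free], fun f v => by simp [FO.sat, Term.val]⟩

theorem lt {s t : Term intZ} (hs : s.1 ∈ S) (ht : t.1 ∈ S) :
    FODefinable S fun _ v => s.val v < t.val v :=
  ⟨.lt s t, by simp [FO.free, Set.insert_subset_iff, hs, ht], fun _ _ => Iff.rfl⟩

theorem lt_var {x y : ℕ} (hx : x ∈ S) (hy : y ∈ S) : FODefinable S fun _ v => v x < v y :=
  (lt (s := (x, 0)) (t := (y, 0)) hx hy).congr fun _ _ => by simp [Term.val]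

theorem neg (hΦ : FODefinable S Φ) : FODefinable S fun f v => ¬ Φ f v := by
  obtain ⟨φ, hS, hφ⟩ := hΦ
  exact ⟨.neg φ, hS, fun f v => not_congr (hφ f v)⟩

theorem and (hΦ : FODefinable S Φ) (hΨ : FODefinable S Ψ) :
    FODefinable S fun f v => Φ f v ∧ Ψ f v := by
  obtain ⟨φ, hS, hφ⟩ := hΦ
  obtain ⟨ψ, hS', hψ⟩ := hΨ
  exact ⟨.conj φ ψ, Set.union_subset hS hS', fun f v => and_congr (hφ f v) (hψ f v)⟩

theorem ex (x : ℕ) (hΦ : FODefinable (insert x S) Φ) :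
    FODefinable S fun f v => ∃ r, Φ f (Function.update v x r) := by
  obtain ⟨φ, hS, hφ⟩ := hΦ
  exact ⟨.ex x φ, Set.sdiff_subset_iff.2 hS, fun f v => exists_congr fun r => hφ f _⟩

theorem mem_interval (I : MTLI intZ) {x y : ℕ} (hx : x ∈ S) (hy : y ∈ S) :
    FODefinable S fun _ v => I.mem (v y - v x) := by
  obtain ⟨lo, lo_mem, -, loC, hi, hi_mem, hiC, -⟩ := I
  refine and (Φ := fun _ v => if loC then lo ≤ v y - v x else lo < v y - v x)
    (Ψ := fun _ v => ∀ h : ℝ, hi = some h → if hiC then v y - v x ≤ h else v y - v x < h) ?_ ?_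
  · cases loC
    · refine (lt (s := (x, ⟨lo, lo_mem⟩)) (t := (y, 0)) hx hy).congr fun f v => ?_
      simp [Term.val, lt_sub_iff_add_lt']
    · refine (lt (s := (y, 0)) (t := (x, ⟨lo, lo_mem⟩)) hy hx).neg.congr fun f v => ?_
      simp [Term.val, le_sub_iff_add_le']
  · cases hi with
    | none => exact tt.congr fun f v => by simp
    | some h =>
      have hm := (hi_mem h rfl).1
      cases hiC
      · refine (lt (s := (y, 0)) (t := (x, ⟨h, hm⟩)) hy hx).congr fun f v => ?_
        simp [Term.val, sub_lt_iff_lt_add']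
      · refine (lt (s := (x, ⟨h, hm⟩)) (t := (y, 0)) hx hy).neg.congr fun f v => ?_
        simp [Term.val, add_comm]

variable {A B : Pred}

theorem forall_between {x y z : ℕ} (hx : x ≠ z) (hy : y ≠ z) (hxS : x ∈ S) (hyS : y ∈ S)
    (hA : FODefinable {z} fun f v => A f (v z)) :
    FODefinable S fun f v => ∀ u, v x < u → u < v y → A f u :=
  (ex z ((lt_var (x := x) (y := z) (by simp [hxS]) (by simp)).and
    ((lt_var (x := z) (y := y) (by simp) (by simp [hyS])).and
      (hA.neg.mono (by simp))))).neg.congr fun f v => by simp [hx, hy]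

theorem untl (I : MTLI intZ) (hA : ∀ x, FODefinable {x} fun f v => A f (v x))
    (hB : ∀ x, FODefinable {x} fun f v => B f (v x)) (x : ℕ) : FODefinable {x} fun f v =>
      ∃ t, v x < t ∧ I.mem (t - v x) ∧ B f t ∧ ∀ u, v x < u → u < t → A f u :=
  (ex (x + 1) ((lt_var (x := x) (y := x + 1) (by simp) (by simp)).and
    ((mem_interval I (x := x) (y := x + 1) (by simp) (by simp)).and
      (((hB (x + 1)).mono (by simp)).and
        (forall_between (x := x) (y := x + 1) (z := x + 2) (by simp) (by simp) (by simp)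
          (by simp) (hA (x + 2))))))).congr fun f v => by simp

theorem sinc (I : MTLI intZ) (hA : ∀ x, FODefinable {x} fun f v => A f (v x))
    (hB : ∀ x, FODefinable {x} fun f v => B f (v x)) (x : ℕ) : FODefinable {x} fun f v =>
      ∃ t, t < v x ∧ I.mem (v x - t) ∧ B f t ∧ ∀ u, t < u → u < v x → A f u :=
  (ex (x + 1) ((lt_var (x := x + 1) (y := x) (by simp) (by simp)).and
    ((mem_interval I (x := x + 1) (y := x) (by simp) (by simp)).and
      (((hB (x + 1)).mono (by simp)).and
        (forall_between (x := x + 1) (y := x) (z := x + 2) (by simp) (by simp) (by simp)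
          (by simp) (hA (x + 2))))))).congr fun f v => by simp

theorem pat_replicate (hA : ∀ x, FODefinable {x} fun f v => A f (v x)) (n : ℕ) :
    ∀ {S : Set ℕ} {s t : Term intZ}, s.1 ∈ S → t.1 ∈ S →
      FODefinable S fun f v => Pat (List.replicate n A) f (s.val v) (t.val v) := by
  induction n with
  | zero => exact fun hs ht => lt hs ht
  | succ n ih =>
    intro S s t hs ht
    set k := s.1 + t.1 + 1 with hk
    have hsk : s.1 ≠ k := by omega
    have htk : t.1 ≠ k := by omega
    refine (ex k ((lt (s := (k, 0)) (t := t) (by simp) (by simp [ht])).and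
      ((ih (s := s) (t := (k, 0)) (by simp [hs]) (by simp)).and
        ((hA k).mono (by simp))))).congr fun f v => ?_
    simp [Term.val, hsk, htk, List.replicate_succ, Pat]

theorem of_mtlc (ψ : MTLC intZ ℕ) : ∀ x, FODefinable {x} fun f v => ψ.sat f (v x) := by
  have h1 : (1 : ℝ) ∈ intZ := AddSubgroup.mem_zmultiples 1
  induction ψ with
  | tt => exact fun _ => tt
  | atom p => exact atom p
  | conj _ _ ih1 ih2 => exact fun x => (ih1 x).and (ih2 x)
  | neg _ ih => exact fun x => (ih x).neg
  | untl φ ψ I ih1 ih2 => exact untl I ih1 ih2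
  | sinc φ ψ I ih1 ih2 => exact sinc I ih1 ih2
  | fcount n φ ih =>
    intro x
    refine (pat_replicate ih n (S := {x}) (s := (x, 0)) (t := (x, ⟨1, h1⟩)) rfl rfl).congr
      fun f v => ?_
    have := Pat.replicate_iff (fun f r => φ.sat f r) n (lt_add_one (v x)) (f := f)
    simpa only [Term.val, MTLC.sat, add_zero, ZeroMemClass.coe_zero] using this
  | pcount n φ ih =>
    intro x
    refine (pat_replicate ih n (S := {x}) (s := (x, -⟨1, h1⟩)) (t := (x, 0)) rfl rfl).congr
      fun f v => ?_
    have := Pat.replicate_iff (fun f r => φ.sat f r) n (sub_one_lt (v x)) (f := f)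
    simpa only [Term.val, MTLC.sat, add_zero, ZeroMemClass.coe_zero, NegMemClass.coe_neg,
      ← sub_eq_add_neg] using this

end FODefinable

/-- **Theorem 2.** `MTL_ℤ+C` has the same expressive power as `FO_ℤ`: every `FO_ℤ` formula
with one free variable has an equivalent `MTL_ℤ+C` formula and vice versa. -/
theorem mtlc_int_eq_fo_int :
    (∀ φ : FO intZ ℕ, φ.free ⊆ {0} → ∃ ψ : MTLC intZ ℕ, EquivFOMTLC φ ψ) ∧
    (∀ ψ : MTLC intZ ℕ, ∃ φ : FO intZ ℕ, φ.free ⊆ {0} ∧ EquivFOMTLC φ ψ) := by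
  refine ⟨fun φ _ => ?_, fun ψ => ?_⟩
  · obtain ⟨ψ, hψ⟩ := (Separated.fo φ).definable
    exact ⟨ψ, fun f r => (hψ f r).symm⟩
  · obtain ⟨φ, hφ, h⟩ := FODefinable.of_mtlc ψ 0
    exact ⟨φ, hφ, fun f r => h f fun _ => r⟩

end MTLPaper
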